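/- arXiv:1104.4008 — 4 statements merged into one kernel-verified Lean document; each statement's English description precedes it below -/
import Mathlib

section
/- For every n ∈ ℤ and every q ∈ (0,1): ∑_{k,l ≥ 0, k−l = n} q^{kl − k/2 − l/2} / ((q)_k (q)_l) = (q^{n/2} + q^{−n/2}) / (q;q)_∞. -/
open Real

/-- The `q`-Pochhammer symbol `(q;q)_n = ∏_{k=1}^n (1 - q^k)`. -/
noncomputable def qPoch (q : ℝ) (n : ℕ) : ℝ := ∏ k ∈ Finset.range n, (1 - q ^ (k + 1))

/-- The infinite `q`-Pochhammer symbol `(q;q)_∞ = ∏_{k=1}^∞ (1 - q^k)`. -/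
noncomputable def qPochInf (q : ℝ) : ℝ := ∏' k : ℕ, (1 - q ^ (k + 1))

open Filter Topology

lemma qPoch_succ (q : ℝ) (n : ℕ) : qPoch q (n + 1) = qPoch q n * (1 - q ^ (n + 1)) := by
  simp [qPoch, Finset.prod_range_succ]

lemma one_sub_pow_pos' {q : ℝ} (h0 : 0 < q) (h1 : q < 1) (n : ℕ) : 0 < 1 - q ^ (n + 1) := by
  have := pow_lt_one₀ h0.le h1 (Nat.succ_ne_zero n)
  simpa using this

lemma qPoch_pos {q : ℝ} (h0 : 0 < q) (h1 : q < 1) (n : ℕ) : 0 < qPoch q n :=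
  Finset.prod_pos fun i _ => one_sub_pow_pos' h0 h1 i

lemma summable_aux {q : ℝ} (h0 : 0 < q) (h1 : q < 1) :
    Summable fun k : ℕ => ‖-q ^ (k + 1)‖ := by
  have h : Summable fun k : ℕ => q ^ (k + 1) :=
    (summable_nat_add_iff 1).2 (summable_geometric_of_lt_one h0.le h1)
  refine h.congr fun k => ?_
  rw [norm_neg, Real.norm_of_nonneg (by positivity)]

lemma tendsto_qPoch {q : ℝ} (h0 : 0 < q) (h1 : q < 1) :
    Tendsto (qPoch q) atTop (𝓝 (qPochInf q)) := by
  have h := multipliable_one_add_of_summable (summable_aux h0 h1)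
  have := h.tendsto_prod_tprod_nat
  simp only [← sub_eq_add_neg] at this
  exact this

lemma qPoch_anti {q : ℝ} (h0 : 0 < q) (h1 : q < 1) : Antitone (qPoch q) := by
  refine antitone_nat_of_succ_le fun n => ?_
  rw [qPoch_succ]
  have := qPoch_pos h0 h1 n
  have : 0 < q ^ (n + 1) := by positivity
  nlinarith

lemma qPochInf_le {q : ℝ} (h0 : 0 < q) (h1 : q < 1) (n : ℕ) : qPochInf q ≤ qPoch q n :=
  (qPoch_anti h0 h1).le_of_tendsto (tendsto_qPoch h0 h1) n

lemma qPochInf_pos {q : ℝ} (h0 : 0 < q) (h1 : q < 1) : 0 < qPochInf q := by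
  have hne : qPochInf q ≠ 0 := by
    have := tprod_one_add_ne_zero_of_summable (f := fun k : ℕ => -q ^ (k + 1))
      (fun i => by
        have := one_sub_pow_pos' h0 h1 i
        rw [← sub_eq_add_neg]; exact this.ne') (summable_aux h0 h1)
    simpa [qPochInf, ← sub_eq_add_neg] using this
  have : 0 ≤ qPochInf q :=
    ge_of_tendsto' (tendsto_qPoch h0 h1) fun n => (qPoch_pos h0 h1 n).le
  exact lt_of_le_of_ne this hne.symm

/-- Terms of the Durfee rectangle sum. -/
noncomputable def durT (q : ℝ) (m j : ℕ) : ℝ := q ^ (j * (j + m)) / (qPoch q j * qPoch q (j + m))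

lemma durT_nonneg {q : ℝ} (h0 : 0 < q) (h1 : q < 1) (m j : ℕ) : 0 ≤ durT q m j := by
  have := qPoch_pos h0 h1 j
  have := qPoch_pos h0 h1 (j + m)
  unfold durT; positivity

lemma durT_le {q : ℝ} (h0 : 0 < q) (h1 : q < 1) (m j : ℕ) :
    durT q m j ≤ q ^ j / (qPochInf q * qPochInf q) := by
  have hp := qPochInf_pos h0 h1
  have := qPoch_pos h0 h1 j
  unfold durT
  have h2 : q ^ (j * (j + m)) ≤ q ^ j := by
    apply pow_le_pow_of_le_one h0.le h1.le
    rcases j with _ | j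
    · simp
    · nlinarith [Nat.zero_le (j * (j+1+m)), Nat.zero_le m, Nat.zero_le j]
  have := qPochInf_le h0 h1 j
  have := qPochInf_le h0 h1 (j + m)
  gcongr

lemma summable_bound {q : ℝ} (h0 : 0 < q) (h1 : q < 1) :
    Summable fun j : ℕ => q ^ j / (qPochInf q * qPochInf q) :=
  (summable_geometric_of_lt_one h0.le h1).div_const _

lemma summable_durT {q : ℝ} (h0 : 0 < q) (h1 : q < 1) (m : ℕ) : Summable (durT q m) :=
  (summable_bound h0 h1).of_nonneg_of_le (durT_nonneg h0 h1 m) (durT_le h0 h1 m)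

lemma durT_rec {q : ℝ} (h0 : 0 < q) (h1 : q < 1) (m : ℕ) :
    ∑' j, durT q m j - ∑' j, durT q (m + 1) j =
      q ^ (m + 1) * (∑' j, durT q (m + 2) j - ∑' j, durT q (m + 1) j) := by
  have s0 := summable_durT h0 h1 m
  have s1 := summable_durT h0 h1 (m + 1)
  have s2 := summable_durT h0 h1 (m + 2)
  have sU := (s0.sub s1).add (s1.mul_left (q ^ (m + 1)))
  have e1 := (s0.sub s1).tsum_add (s1.mul_left (q ^ (m + 1)))
  rw [s0.tsum_sub s1, tsum_mul_left] at e1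
  have e2 := sU.tsum_eq_zero_add
  have e3 : durT q m 0 - durT q (m + 1) 0 + q ^ (m + 1) * durT q (m + 1) 0 = 0 := by
    have a := (qPoch_pos h0 h1 m).ne'
    have b := (one_sub_pow_pos' h0 h1 m).ne'
    have c : qPoch q 0 = 1 := by simp [qPoch]
    simp only [durT, zero_add, zero_mul, pow_zero, qPoch_succ, c]
    field_simp
    ring
  have e4 : ∀ j, durT q m (j + 1) - durT q (m + 1) (j + 1) + q ^ (m + 1) * durT q (m + 1) (j + 1)
      = q ^ (m + 1) * durT q (m + 2) j := by
    intro j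
    have a := (qPoch_pos h0 h1 j).ne'
    have b := (qPoch_pos h0 h1 (j + m + 1)).ne'
    have c := (one_sub_pow_pos' h0 h1 j).ne'
    have d := (one_sub_pow_pos' h0 h1 (j + m + 1)).ne'
    simp only [durT]
    rw [show j + 1 + m = j + m + 1 by ring, show j + 1 + (m + 1) = j + m + 1 + 1 by ring,
      show j + (m + 2) = j + m + 1 + 1 by ring, qPoch_succ q (j + m + 1), qPoch_succ q j]
    field_simp
    ring
  simp only [e4] at e2
  rw [tsum_mul_left] at e2
  linarith

lemma durT_const {q : ℝ} (h0 : 0 < q) (h1 : q < 1) (m : ℕ) :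
    ∑' j, durT q m j = ∑' j, durT q (m + 1) j := by
  set D : ℕ → ℝ := fun m => ∑' j, durT q m j - ∑' j, durT q (m + 1) j with hD
  set C : ℝ := ∑' j : ℕ, q ^ j / (qPochInf q * qPochInf q) with hC
  have hA0 : ∀ m, 0 ≤ ∑' j, durT q m j := fun m => tsum_nonneg (durT_nonneg h0 h1 m)
  have hA1 : ∀ m, ∑' j, durT q m j ≤ C := fun m =>
    (summable_durT h0 h1 m).tsum_le_tsum (durT_le h0 h1 m) (summable_bound h0 h1)
  have hDb : ∀ m, |D m| ≤ C := by
    intro m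
    rw [abs_le]
    constructor <;> simp only [hD] <;> linarith [hA0 m, hA0 (m + 1), hA1 m, hA1 (m + 1)]
  have hstep : ∀ m, |D m| ≤ q * |D (m + 1)| := by
    intro m
    have : D m = q ^ (m + 1) * (-D (m + 1)) := by
      simp only [hD]; rw [durT_rec h0 h1 m]; ring
    rw [this, abs_mul, abs_neg, abs_of_pos (by positivity)]
    gcongr
    exact pow_le_of_le_one h0.le h1.le (by simp)
  have hk : ∀ k m, |D m| ≤ q ^ k * C := by
    intro k
    induction k with
    | zero => intro m; simpa using hDb m
    | succ k ih =>
      intro m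
      calc |D m| ≤ q * |D (m + 1)| := hstep m
        _ ≤ q * (q ^ k * C) := by gcongr; exact ih _
        _ = q ^ (k + 1) * C := by ring
  have hlim : Tendsto (fun k : ℕ => q ^ k * C) atTop (𝓝 0) := by
    simpa using (tendsto_pow_atTop_nhds_zero_of_lt_one h0.le h1).mul_const C
  have : |D m| ≤ 0 := ge_of_tendsto' hlim fun k => hk k m
  have := abs_nonpos_iff.1 this
  simp only [hD] at this
  linarith

lemma durT_tsum {q : ℝ} (h0 : 0 < q) (h1 : q < 1) (m : ℕ) :
    ∑' j, durT q m j = 1 / qPochInf q := by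
  have hc : ∀ m, ∑' j, durT q m j = ∑' j, durT q 0 j := by
    intro m
    induction m with
    | zero => rfl
    | succ m ih => rw [← durT_const h0 h1, ih]
  have hp := qPochInf_pos h0 h1
  have hl : Tendsto (fun m => ∑' j, durT q m j) atTop
      (𝓝 (∑' j : ℕ, if j = 0 then 1 / qPochInf q else 0)) := by
    refine tendsto_tsum_of_dominated_convergence (summable_bound h0 h1) ?_ ?_
    · intro j
      rcases j with _ | j
      · have c : qPoch q 0 = 1 := by simp [qPoch]
        simp only [durT, zero_add, zero_mul, pow_zero, c, one_mul, if_true]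
        exact tendsto_const_nhds.div (tendsto_qPoch h0 h1) hp.ne'
      · simp only [Nat.add_eq_zero_iff, one_ne_zero, and_false, if_false]
        have hlim : Tendsto (fun k : ℕ => q ^ k * (1 / (qPochInf q * qPochInf q))) atTop (𝓝 0) := by
          simpa using (tendsto_pow_atTop_nhds_zero_of_lt_one h0.le h1).mul_const
            (1 / (qPochInf q * qPochInf q))
        refine squeeze_zero (fun m => durT_nonneg h0 h1 m _) (fun m => ?_) hlim
        have := qPochInf_le h0 h1 (j + 1)
        have := qPochInf_le h0 h1 (j + 1 + m)
        have h2 : q ^ ((j + 1) * (j + 1 + m)) ≤ q ^ m := by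
          apply pow_le_pow_of_le_one h0.le h1.le
          nlinarith [Nat.zero_le (j * (j+1+m))]
        have := qPoch_pos h0 h1 (j + 1)
        rw [mul_one_div]
        unfold durT
        gcongr
    · refine Eventually.of_forall fun m j => ?_
      rw [Real.norm_of_nonneg (durT_nonneg h0 h1 m j)]
      exact durT_le h0 h1 m j
  rw [tsum_ite_eq] at hl
  have h2 : Tendsto (fun m => ∑' j, durT q m j) atTop (𝓝 (∑' j, durT q 0 j)) := by
    simp only [hc]; exact tendsto_const_nhds
  rw [hc m]
  exact tendsto_nhds_unique h2 hl

lemma shifted_tsum {q : ℝ} (h0 : 0 < q) (h1 : q < 1) (m : ℕ) :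
    ∑' j : ℕ, q ^ (j * (j + m) - j) / (qPoch q j * qPoch q (j + m)) =
      (1 + q ^ m) / qPochInf q := by
  set V : ℕ → ℝ := fun j => q ^ (j * (j + m) - j) / (qPoch q j * qPoch q (j + m)) with hV
  have s0 := summable_durT h0 h1 m
  have s1 := summable_durT h0 h1 (m + 1)
  have s0' := (summable_nat_add_iff 1).2 s0
  have hV0 : V 0 = durT q m 0 := by simp [hV, durT]
  have hVs : ∀ j, V (j + 1) = durT q m (j + 1) + q ^ m * durT q (m + 1) j := by
    intro j
    have a := (qPoch_pos h0 h1 j).ne'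
    have b := (qPoch_pos h0 h1 (j + m + 1)).ne'
    have c := (one_sub_pow_pos' h0 h1 j).ne'
    have e : (j + 1) * (j + 1 + m) - (j + 1) = (j + 1) * (j + m) := by
      rw [Nat.sub_eq_iff_eq_add (by nlinarith [Nat.zero_le ((j + 1) * (j + m))])]; ring
    simp only [hV, durT]
    rw [e, show j + (m + 1) = j + m + 1 by ring, show j + 1 + m = j + m + 1 by ring,
      qPoch_succ q j]
    field_simp
    ring
  have sV : Summable V := by
    rw [← summable_nat_add_iff 1]
    simp only [hVs]
    exact s0'.add (s1.mul_left _)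
  rw [sV.tsum_eq_zero_add, hV0]
  simp only [hVs]
  rw [s0'.tsum_add (s1.mul_left _), tsum_mul_left, ← add_assoc, ← s0.tsum_eq_zero_add,
    durT_tsum h0 h1, durT_tsum h0 h1]
  ring

lemma term_eq {q : ℝ} (h0 : 0 < q) (m j : ℕ) (x : ℝ)
    (hx : x = (j : ℝ) * (j + m) - j - m / 2) :
    q ^ x = q ^ (-(m : ℝ) / 2) * q ^ (j * (j + m) - j) := by
  have hle : j ≤ j * (j + m) := by
    rcases j with _ | j
    · simp
    · nlinarith [Nat.zero_le (j * (j+1+m))]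
  rw [← Real.rpow_natCast, ← Real.rpow_add h0, hx]
  congr 1
  push_cast [Nat.cast_sub hle]
  ring

lemma final_eq {q : ℝ} (h0 : 0 < q) (h1 : q < 1) (m : ℕ) :
    ∑' j : ℕ, q ^ (-(m : ℝ) / 2) * (q ^ (j * (j + m) - j) / (qPoch q j * qPoch q (j + m))) =
      (q ^ ((m : ℝ) / 2) + q ^ (-(m : ℝ) / 2)) / qPochInf q := by
  rw [tsum_mul_left, shifted_tsum h0 h1]
  have : q ^ ((m : ℝ) / 2) = q ^ (-(m : ℝ) / 2) * q ^ m := by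
    rw [← Real.rpow_natCast, ← Real.rpow_add h0]
    congr 1; ring
  rw [this]; ring

/-- For every `n ∈ ℤ` and `q ∈ (0,1)`:
`∑_{k,l ≥ 0, k-l=n} q^{kl - k/2 - l/2} / ((q)_k (q)_l) = (q^{n/2} + q^{-n/2}) / (q;q)_∞`. -/
theorem sum_antidiagonal_qPoch (n : ℤ) (q : ℝ) (hq : q ∈ Set.Ioo (0 : ℝ) 1) :
    (∑' p : ℕ × ℕ,
        if (p.1 : ℤ) - (p.2 : ℤ) = n then
          q ^ ((p.1 : ℝ) * (p.2 : ℝ) - (p.1 : ℝ) / 2 - (p.2 : ℝ) / 2) /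
            (qPoch q p.1 * qPoch q p.2)
        else 0) =
      (q ^ ((n : ℝ) / 2) + q ^ (-(n : ℝ) / 2)) / qPochInf q := by
  obtain ⟨h0, h1⟩ := hq
  obtain ⟨m, rfl | rfl⟩ := n.eq_nat_or_neg
  · have hinj : Function.Injective (fun j : ℕ => (j + m, j)) := fun a b h => (Prod.ext_iff.1 h).2
    rw [← hinj.tsum_eq]
    · rw [Int.cast_natCast, ← final_eq h0 h1 m]
      refine tsum_congr fun j => ?_
      rw [if_pos (by push_cast; ring), term_eq h0 m j _ (by push_cast; ring)]
      ring
    · rintro ⟨a, b⟩ h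
      simp only [Function.mem_support, ne_eq, ite_eq_right_iff, Classical.not_imp] at h
      exact ⟨b, Prod.ext (by have := h.1; simp only; omega) rfl⟩
  · have hinj : Function.Injective (fun j : ℕ => (j, j + m)) := fun a b h => (Prod.ext_iff.1 h).1
    rw [← hinj.tsum_eq]
    · rw [Int.cast_neg, Int.cast_natCast, neg_neg, add_comm, ← final_eq h0 h1 m]
      refine tsum_congr fun j => ?_
      rw [if_pos (by push_cast; ring), term_eq h0 m j _ (by push_cast; ring)]
      ring
    · rintro ⟨a, b⟩ h
      simp only [Function.mem_support, ne_eq, ite_eq_right_iff, Classical.not_imp] at h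
      exact ⟨a, Prod.ext rfl (by have := h.1; simp only; omega)⟩
end

section
/- For every real a > 1/2 and every q ∈ (0,1): ∑_{k,l ≥ 0} q^{(a/2)(k²+l²) + (1−a)kl − (k+l)/2} / ((q)_k (q)_l) = (2/(q;q)_∞)·∑_{n ∈ ℤ} q^{(a/2)(n + 1/(2a))² − 1/(8a)}. Equivalently, for A = (a, 1−a; 1−a, a), B = (−1/2, −1/2) and C = 1/(8a) − 1/24, one has F_{A,B,C}(e^{2πiz}) = (2/η(z))·∑_{n ∈ ℤ + 1/(2a)} q^{an²/2} where q = e^{2πiz} and η(z) = q^{1/24}∏_{n≥1}(1−q^n). -/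
open Real

/-- The Nahm sum `F_{A,B,C}(q) = ∑_{n ∈ (ℤ_{≥0})^ι} q^{½nᵀAn + nᵀB + C} / ∏ᵢ (q)_{nᵢ}`. -/
noncomputable def nahmSum {ι : Type*} [Fintype ι]
    (A : Matrix ι ι ℝ) (B : ι → ℝ) (C : ℝ) (q : ℝ) : ℝ :=
  ∑' n : ι → ℕ,
    q ^ ((1 / 2) * (∑ i, ∑ j, (n i : ℝ) * A i j * (n j : ℝ)) +
          (∑ i, (n i : ℝ) * B i) + C) / ∏ i, qPoch q (n i)

open Filter Topology

section aux
variable {q : ℝ}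

lemma qP_zero : qPoch q 0 = 1 := by simp [qPoch]

lemma qP_succ (n : ℕ) : qPoch q (n + 1) = qPoch q n * (1 - q ^ (n + 1)) := by
  simp [qPoch, Finset.prod_range_succ]

lemma fac_pos (h0 : 0 < q) (h1 : q < 1) (n : ℕ) : 0 < 1 - q ^ (n + 1) := by
  have := pow_lt_one₀ h0.le h1 (Nat.succ_ne_zero n)
  simpa using this

lemma qP_pos (h0 : 0 < q) (h1 : q < 1) (n : ℕ) : 0 < qPoch q n :=
  Finset.prod_pos fun k _ => fac_pos h0 h1 k

lemma sum_q (h0 : 0 < q) (h1 : q < 1) : Summable fun n : ℕ => ‖-q ^ (n + 1)‖ := by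
  have := (summable_nat_add_iff 1).mpr (summable_geometric_of_lt_one h0.le h1)
  simpa [abs_of_pos h0] using this

lemma mult_q (h0 : 0 < q) (h1 : q < 1) : Multipliable fun n : ℕ => 1 - q ^ (n + 1) := by
  simpa [sub_eq_add_neg] using multipliable_one_add_of_summable (sum_q h0 h1)

lemma qP_tendsto (h0 : 0 < q) (h1 : q < 1) :
    Tendsto (qPoch q) atTop (𝓝 (qPochInf q)) :=
  (mult_q h0 h1).hasProd.tendsto_prod_nat

lemma qPI_le (h0 : 0 < q) (h1 : q < 1) (n : ℕ) : qPochInf q ≤ qPoch q n := by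
  have ha : Antitone (qPoch q) := antitone_nat_of_succ_le fun n => by
    rw [qP_succ]
    have := qP_pos h0 h1 n
    have : 0 < q ^ (n + 1) := by positivity
    nlinarith
  exact ha.le_of_tendsto (qP_tendsto h0 h1) n

lemma qPI_pos (h0 : 0 < q) (h1 : q < 1) : 0 < qPochInf q := by
  have h2 : 0 ≤ qPochInf q := ge_of_tendsto' (qP_tendsto h0 h1) fun n => (qP_pos h0 h1 n).le
  have h3 : qPochInf q ≠ 0 := by
    have := tprod_one_add_ne_zero_of_summable (f := fun n : ℕ => -q ^ (n + 1))
      (fun i => by have := fac_pos h0 h1 i; rw [← sub_eq_add_neg]; exact this.ne') (sum_q h0 h1)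
    simpa [qPochInf, sub_eq_add_neg] using this
  exact lt_of_le_of_ne h2 h3.symm

/-- summand of the Durfee-type sum -/
noncomputable def ff (q : ℝ) (n l : ℕ) : ℝ := q ^ (l * l + n * l) / (qPoch q l * qPoch q (l + n))

/-- shifted summand -/
noncomputable def tt (q : ℝ) (n l : ℕ) : ℝ :=
  q ^ (l * (l - 1) + n * l) / (qPoch q l * qPoch q (l + n))

lemma inv_bound (h0 : 0 < q) (h1 : q < 1) (x : ℝ) (hx : 0 ≤ x) (m n : ℕ) :
    x / (qPoch q m * qPoch q n) ≤ x / (qPochInf q * qPochInf q) := by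
  have := qPI_pos h0 h1
  have h2 := qPI_le h0 h1 m
  have h3 := qPI_le h0 h1 n
  have h4 := qP_pos h0 h1 m
  gcongr

lemma ff_nonneg (h0 : 0 < q) (h1 : q < 1) (n l : ℕ) : 0 ≤ ff q n l := by
  have := qP_pos h0 h1 l
  have := qP_pos h0 h1 (l + n)
  unfold ff; positivity

lemma tt_nonneg (h0 : 0 < q) (h1 : q < 1) (n l : ℕ) : 0 ≤ tt q n l := by
  have := qP_pos h0 h1 l
  have := qP_pos h0 h1 (l + n)
  unfold tt; positivity

lemma ff_le (h0 : 0 < q) (h1 : q < 1) (n l : ℕ) :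
    ff q n l ≤ q ^ l / (qPochInf q * qPochInf q) := by
  have := qPI_pos h0 h1
  refine (inv_bound h0 h1 _ (by positivity) _ _).trans ?_
  have : q ^ (l * l + n * l) ≤ q ^ l := pow_le_pow_of_le_one h0.le h1.le (by nlinarith [Nat.le_mul_self l])
  gcongr

lemma ff_summable (h0 : 0 < q) (h1 : q < 1) (n : ℕ) : Summable (ff q n) :=
  Summable.of_nonneg_of_le (ff_nonneg h0 h1 n) (ff_le h0 h1 n)
    ((summable_geometric_of_lt_one h0.le h1).div_const _)

/-- the Durfee-type sum -/
noncomputable def UU (q : ℝ) (n : ℕ) : ℝ := ∑' l, ff q n l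

lemma UU_tendsto (h0 : 0 < q) (h1 : q < 1) : Tendsto (UU q) atTop (𝓝 (1 / qPochInf q)) := by
  have hp := qPI_pos h0 h1
  have key : Tendsto (UU q) atTop (𝓝 (∑' l : ℕ, if l = 0 then 1 / qPochInf q else 0)) := by
    refine tendsto_tsum_of_dominated_convergence
      (bound := fun l => q ^ l / (qPochInf q * qPochInf q))
      ((summable_geometric_of_lt_one h0.le h1).div_const _) ?_ ?_
    · intro l
      rcases l with _ | l
      · simpa [ff, qP_zero] using (qP_tendsto h0 h1).inv₀ hp.ne'
      · simp only [Nat.succ_ne_zero, if_false]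
        refine squeeze_zero (fun n => ff_nonneg h0 h1 n _)
          (g := fun n => q ^ n / (qPochInf q * qPochInf q)) (fun n => ?_) ?_
        · refine (inv_bound h0 h1 _ (by positivity) _ _).trans ?_
          have : q ^ ((l+1) * (l+1) + n * (l+1)) ≤ q ^ n :=
            pow_le_pow_of_le_one h0.le h1.le (by nlinarith [Nat.zero_le (n*l)])
          gcongr
        · simpa using (tendsto_pow_atTop_nhds_zero_of_lt_one h0.le h1).div_const
            (qPochInf q * qPochInf q)
    · filter_upwards with n l
      rw [Real.norm_of_nonneg (ff_nonneg h0 h1 n l)]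
      exact ff_le h0 h1 n l
  simpa using key

lemma hasSum_shift {e g : ℕ → ℝ} {s : ℝ} (he : e 0 = 0) (heg : ∀ l, e (l + 1) = g l)
    (hg : HasSum g s) : HasSum e s := by
  rw [← hasSum_nat_add_iff' 1]
  simpa [he, heg] using hg

lemma UU_rec (h0 : 0 < q) (h1 : q < 1) (n : ℕ) :
    UU q n - UU q (n + 1) = q ^ (n + 1) * (UU q (n + 2) - UU q (n + 1)) := by
  have hs (n) : HasSum (ff q n) (UU q n) := (ff_summable h0 h1 n).hasSum
  have he : HasSum (fun l => ff q n l - ff q (n + 1) l + q ^ (n + 1) * ff q (n + 1) l)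
      (q ^ (n + 1) * UU q (n + 2)) := by
    refine hasSum_shift (g := fun l => q ^ (n + 1) * ff q (n + 2) l) ?_ ?_
      ((hs (n + 2)).mul_left _)
    · have h2 := qP_pos h0 h1 n
      have h3 := fac_pos h0 h1 n
      simp only [ff, qP_zero, zero_add, mul_zero, pow_zero, qP_succ]
      field_simp
      ring
    · intro l
      have h2 := qP_pos h0 h1 l
      have h3 := fac_pos h0 h1 l
      have h4 := qP_pos h0 h1 (l + n + 1)
      have h5 := fac_pos h0 h1 (l + n + 1)
      simp only [ff]
      rw [show l + 1 + n = l + n + 1 by ring, show l + 1 + (n + 1) = l + n + 1 + 1 by ring,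
        show l + (n + 2) = l + n + 1 + 1 by ring, qP_succ l, qP_succ (l + n + 1)]
      field_simp
      ring
  have h := ((hs n).sub (hs (n + 1))).add ((hs (n + 1)).mul_left (q ^ (n + 1)))
  have := h.unique he
  linarith

lemma UU_eq (h0 : 0 < q) (h1 : q < 1) (n : ℕ) : UU q n = 1 / qPochInf q := by
  have ht := UU_tendsto h0 h1
  have hD : Tendsto (fun n => |UU q n - UU q (n + 1)|) atTop (𝓝 0) := by
    have := (ht.sub (ht.comp (tendsto_add_atTop_nat 1))).abs
    simpa using this
  have hm : Monotone (fun n => |UU q n - UU q (n + 1)|) := monotone_nat_of_le_succ fun n => by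
    rw [UU_rec h0 h1 n, abs_mul, abs_sub_comm (UU q (n + 2)), abs_of_pos (by positivity)]
    exact mul_le_of_le_one_left (abs_nonneg _) (pow_le_one₀ h0.le h1.le)
  have hz (n) : UU q (n + 1) = UU q n := by
    have := hm.ge_of_tendsto hD n
    have := abs_nonpos_iff.mp this
    linarith
  have hc (n) : UU q n = UU q 0 := by
    induction n with
    | zero => rfl
    | succ k ih => rw [hz, ih]
  have : UU q = fun _ => UU q 0 := funext hc
  rw [this] at ht ⊢
  exact tendsto_nhds_unique tendsto_const_nhds ht

lemma tt_hasSum (h0 : 0 < q) (h1 : q < 1) (n : ℕ) :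
    HasSum (tt q n) ((1 + q ^ n) / qPochInf q) := by
  have hs (n) : HasSum (ff q n) (1 / qPochInf q) := by
    rw [← UU_eq h0 h1 n]; exact (ff_summable h0 h1 n).hasSum
  have he : HasSum (fun l => tt q n l - ff q n l) (q ^ n * (1 / qPochInf q)) := by
    refine hasSum_shift (g := fun l => q ^ n * ff q (n + 1) l) ?_ ?_ ((hs (n + 1)).mul_left _)
    · simp [tt, ff]
    · intro l
      have h2 := qP_pos h0 h1 l
      have h3 := fac_pos h0 h1 l
      have h4 := qP_pos h0 h1 (l + n + 1)
      simp only [ff, tt]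
      rw [show l + 1 + n = l + n + 1 by ring, show l + (n + 1) = l + n + 1 by ring, qP_succ l,
        Nat.add_sub_cancel]
      field_simp
      ring
  have := (hs n).add he
  convert this using 1
  · funext l; ring
  · ring

/-- `(k, l) ↦ (k - l, min k l)` -/
def diffMin : ℕ × ℕ ≃ ℤ × ℕ where
  toFun p := ((p.1 : ℤ) - p.2, min p.1 p.2)
  invFun p := (p.2 + p.1.toNat, p.2 + (-p.1).toNat)
  left_inv p := by
    rcases p with ⟨k, l⟩
    ext <;> simp <;> omega
  right_inv p := by
    rcases p with ⟨k, l⟩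
    ext <;> simp <;> omega

lemma theta_summable (h0 : 0 < q) (h1 : q < 1) {a : ℝ} (ha : 0 < a) :
    Summable fun n : ℤ => q ^ ((a / 2) * ((n : ℝ) + 1 / (2 * a)) ^ 2 - 1 / (8 * a)) := by
  have hl : 0 < -Real.log q := by linarith [Real.log_neg h0 h1]
  have := (HurwitzZeta.hasSum_int_evenKernel (1 / (2 * a))
    (t := -Real.log q * a / (2 * π)) (by positivity)).summable.mul_right (q ^ (- (1 / (8 * a))))
  refine this.congr fun n => ?_
  rw [sub_eq_add_neg, Real.rpow_add h0, Real.rpow_def_of_pos h0 (_ / _ * _)]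
  congr 2
  field_simp

lemma theta_term {a : ℝ} (ha : 0 < a) (x : ℝ) :
    (a / 2) * (x + 1 / (2 * a)) ^ 2 - 1 / (8 * a) = a / 2 * x ^ 2 + x / 2 := by
  field_simp; ring

lemma term_eq_s13 (h0 : 0 < q) (h1 : q < 1) (a : ℝ) (n : ℤ) (l : ℕ) :
    (fun p : ℕ × ℕ => q ^ ((a / 2) * (((p.1 : ℝ)) ^ 2 + ((p.2 : ℝ)) ^ 2) +
              (1 - a) * (p.1 : ℝ) * (p.2 : ℝ) - ((p.1 : ℝ) + (p.2 : ℝ)) / 2) /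
          (qPoch q p.1 * qPoch q p.2)) (diffMin.symm (n, l)) =
      q ^ (a / 2 * (n : ℝ) ^ 2 - (n.natAbs : ℝ) / 2) * tt q n.natAbs l := by
  have hl : ((l * (l - 1) : ℕ) : ℝ) = (l : ℝ) * (l - 1) := by
    rcases l with _ | l <;> simp
  simp only [diffMin, Equiv.coe_fn_symm_mk, tt]
  rw [← mul_div_assoc, ← Real.rpow_natCast q, ← Real.rpow_add h0]
  obtain ⟨m, rfl | rfl⟩ := n.eq_nat_or_neg
  · simp only [Int.toNat_natCast, Int.toNat_neg_natCast, Int.natAbs_natCast, Nat.cast_add, hl,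
      Nat.cast_mul, add_zero, Nat.cast_zero, Int.cast_natCast]
    rw [mul_comm (qPoch q _)]
    congr 2
    ring
  · simp only [neg_neg, Int.toNat_natCast, Int.toNat_neg_natCast, Int.natAbs_neg,
      Int.natAbs_natCast, Nat.cast_add, hl, Int.cast_neg,
      Nat.cast_mul, add_zero, Nat.cast_zero, Int.cast_natCast]
    congr 2
    ring

lemma inner_eq (h0 : 0 < q) {a : ℝ} (ha : 0 < a) (n : ℤ) :
    q ^ (a / 2 * (n : ℝ) ^ 2 - (n.natAbs : ℝ) / 2) * ((1 + q ^ n.natAbs) / qPochInf q) =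
     (q ^ ((a / 2) * ((n : ℝ) + 1 / (2 * a)) ^ 2 - 1 / (8 * a)) +
      q ^ ((a / 2) * (((-n : ℤ) : ℝ) + 1 / (2 * a)) ^ 2 - 1 / (8 * a))) / qPochInf q := by
  rw [theta_term ha, theta_term ha, ← mul_div_assoc, mul_add, mul_one, ← Real.rpow_natCast q,
    ← Real.rpow_add h0]
  obtain ⟨m, rfl | rfl⟩ := n.eq_nat_or_neg
  · simp only [Int.natAbs_natCast, Int.cast_natCast, Int.cast_neg]
    rw [add_comm]
    congr 3 <;> ring
  · simp only [Int.natAbs_neg, Int.natAbs_natCast, Int.cast_natCast, Int.cast_neg]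
    congr 3 <;> ring

lemma main1 (h0 : 0 < q) (h1 : q < 1) {a : ℝ} (ha : 0 < a) :
    ∑' p : ℕ × ℕ,
        q ^ ((a / 2) * (((p.1 : ℝ)) ^ 2 + ((p.2 : ℝ)) ^ 2) +
              (1 - a) * (p.1 : ℝ) * (p.2 : ℝ) - ((p.1 : ℝ) + (p.2 : ℝ)) / 2) /
          (qPoch q p.1 * qPoch q p.2) =
      2 / qPochInf q *
        ∑' n : ℤ, q ^ ((a / 2) * ((n : ℝ) + 1 / (2 * a)) ^ 2 - 1 / (8 * a)) := by
  have hth := theta_summable h0 h1 ha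
  have hth' := (Equiv.neg ℤ).summable_iff.mpr hth
  have hte := (Equiv.neg ℤ).tsum_eq
    (fun n : ℤ => q ^ ((a / 2) * ((n : ℝ) + 1 / (2 * a)) ^ 2 - 1 / (8 * a)))
  have hin (n : ℤ) : HasSum (fun l => q ^ (a / 2 * (n : ℝ) ^ 2 - (n.natAbs : ℝ) / 2) *
      tt q n.natAbs l) _ := (tt_hasSum h0 h1 n.natAbs).mul_left _
  have hout := (hth.hasSum.add hth'.hasSum).div_const (qPochInf q)
  rw [← diffMin.symm.tsum_eq, tsum_congr (fun p : ℤ × ℕ => term_eq_s13 h0 h1 a p.1 p.2)]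
  have hS : Summable fun p : ℤ × ℕ => q ^ (a / 2 * (p.1 : ℝ) ^ 2 - (p.1.natAbs : ℝ) / 2) *
      tt q p.1.natAbs p.2 := by
    rw [summable_prod_of_nonneg]
    · refine ⟨fun n => (hin n).summable, ?_⟩
      refine hout.summable.congr fun n => ?_
      rw [(hin n).tsum_eq, inner_eq h0 ha]
      rfl
    · intro p
      exact mul_nonneg (Real.rpow_nonneg h0.le _) (tt_nonneg h0 h1 _ _)
  rw [hS.tsum_prod]
  have : ∀ n : ℤ, ∑' l, q ^ (a / 2 * (n : ℝ) ^ 2 - (n.natAbs : ℝ) / 2) *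
      tt q n.natAbs l = _ := fun n => ((hin n).tsum_eq).trans (inner_eq h0 ha n)
  rw [tsum_congr this]
  refine hout.tsum_eq.trans ?_
  simp only [Function.comp_def]
  rw [hte]
  ring

end aux


/-- For `a > 1/2` and `q ∈ (0,1)`:
`∑_{k,l ≥ 0} q^{(a/2)(k²+l²)+(1-a)kl-(k+l)/2}/((q)_k (q)_l)
  = (2/(q;q)_∞) ∑_{n ∈ ℤ} q^{(a/2)(n+1/(2a))² - 1/(8a)}`;
equivalently, for `A = (a, 1-a; 1-a, a)`, `B = (-1/2, -1/2)`, `C = 1/(8a) - 1/24`,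
`F_{A,B,C}(q) = (2/η) ∑_{n ∈ ℤ + 1/(2a)} q^{an²/2}` with `η = q^{1/24}(q;q)_∞`. -/
theorem nahmSum_theta_identity (a : ℝ) (ha : 1 / 2 < a)
    (q : ℝ) (hq : q ∈ Set.Ioo (0 : ℝ) 1) :
    (∑' p : ℕ × ℕ,
        q ^ ((a / 2) * (((p.1 : ℝ)) ^ 2 + ((p.2 : ℝ)) ^ 2) +
              (1 - a) * (p.1 : ℝ) * (p.2 : ℝ) - ((p.1 : ℝ) + (p.2 : ℝ)) / 2) /
          (qPoch q p.1 * qPoch q p.2) =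
      2 / qPochInf q *
        ∑' n : ℤ, q ^ ((a / 2) * ((n : ℝ) + 1 / (2 * a)) ^ 2 - 1 / (8 * a))) ∧
    nahmSum (Matrix.of ![![a, 1 - a], ![1 - a, a]]) ![-(1 / 2), -(1 / 2)]
        (1 / (8 * a) - 1 / 24) q =
      2 / (q ^ ((1 : ℝ) / 24) * qPochInf q) *
        ∑' n : ℤ, q ^ (a * ((n : ℝ) + 1 / (2 * a)) ^ 2 / 2) := by
  obtain ⟨h0, h1⟩ := hq
  have ha0 : 0 < a := by linarith
  have hm := main1 h0 h1 ha0
  refine ⟨hm, ?_⟩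
  have hC : ∀ x : ℝ, q ^ (x + (1 / (8 * a) - 1 / 24)) =
      q ^ x * q ^ (1 / (8 * a) - 1 / 24 : ℝ) := fun x => Real.rpow_add h0 _ _
  have h2 : ∀ n : ℤ, q ^ (a * ((n : ℝ) + 1 / (2 * a)) ^ 2 / 2) =
      q ^ ((a / 2) * ((n : ℝ) + 1 / (2 * a)) ^ 2 - 1 / (8 * a)) * q ^ (1 / (8 * a)) := by
    intro n
    rw [← Real.rpow_add h0]
    congr 1
    ring
  rw [tsum_congr h2, tsum_mul_right]
  unfold nahmSum
  rw [← (finTwoArrowEquiv ℕ).symm.tsum_eq]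
  have h3 : ∀ p : ℕ × ℕ, (fun n : Fin 2 → ℕ => q ^ ((1 / 2) * (∑ i, ∑ j, (n i : ℝ) *
        (Matrix.of ![![a, 1 - a], ![1 - a, a]]) i j * (n j : ℝ)) +
          (∑ i, (n i : ℝ) * ![-(1 / 2), -(1 / 2)] i) + (1 / (8 * a) - 1 / 24)) /
          ∏ i, qPoch q (n i)) ((finTwoArrowEquiv ℕ).symm p) =
      q ^ ((a / 2) * (((p.1 : ℝ)) ^ 2 + ((p.2 : ℝ)) ^ 2) +
              (1 - a) * (p.1 : ℝ) * (p.2 : ℝ) - ((p.1 : ℝ) + (p.2 : ℝ)) / 2) /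
          (qPoch q p.1 * qPoch q p.2) * q ^ (1 / (8 * a) - 1 / 24 : ℝ) := by
    intro p
    have e0 : (finTwoArrowEquiv ℕ).symm p 0 = p.1 := rfl
    have e1 : (finTwoArrowEquiv ℕ).symm p 1 = p.2 := rfl
    simp only [hC, e0, e1, Fin.sum_univ_two, Fin.prod_univ_two,
      Matrix.of_apply, Matrix.cons_val_zero, Matrix.cons_val_one]
    rw [div_mul_eq_mul_div]
    congr 3
    ring
  rw [tsum_congr h3, tsum_mul_right, hm, Real.rpow_sub h0]
  have := Real.rpow_pos_of_pos h0 (1 / 24)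
  have := qPI_pos h0 h1
  generalize (∑' n : ℤ, q ^ ((a / 2) * ((n : ℝ) + 1 / (2 * a)) ^ 2 - 1 / (8 * a))) = S
  field_simp
end

section
/- For every q ∈ (0,1): ∑_{m,n ≥ 0} q^{(1/2)m² − (1/2)mn + (1/2)n²} / ((q)_m (q)_n) = (−q^{1/2}; q)_∞ · ∑_{n ≥ 0} q^{(3/2)n²} / ((q^{1/2}; q)_n (q²; q²)_n) + 2 q^{1/2} (−q; q)_∞ · ∑_{n ≥ 0} q^{(3/2)n² + (3/2)n} / ((q)_n (q; q²)_{n+1}). -/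
open Real

/-- The `q`-Pochhammer symbol `(a;q)_n = ∏_{k=1}^n (1 - a q^{k-1})`. -/
noncomputable def genPoch (a q : ℝ) (n : ℕ) : ℝ := ∏ k ∈ Finset.range n, (1 - a * q ^ k)

/-- The infinite `q`-Pochhammer symbol `(a;q)_∞ = ∏_{k=1}^∞ (1 - a q^{k-1})`. -/
noncomputable def genPochInf (a q : ℝ) : ℝ := ∏' k : ℕ, (1 - a * q ^ k)

open Filter Topology

/-- Summand of the double sum, in terms of `t = q^{1/2}`. -/
noncomputable def nterm (t : ℝ) (p : ℕ × ℕ) : ℝ :=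
  t ^ (p.1 ^ 2) * t ^ (p.2 ^ 2) / t ^ (p.1 * p.2) /
    (genPoch (t ^ 2) (t ^ 2) p.1 * genPoch (t ^ 2) (t ^ 2) p.2)

lemma genPoch_succ (a q : ℝ) (n : ℕ) :
    genPoch a q (n + 1) = genPoch a q n * (1 - a * q ^ n) := by
  simp [genPoch, Finset.prod_range_succ]

lemma genPoch_zero (a q : ℝ) : genPoch a q 0 = 1 := by simp [genPoch]

lemma genPoch_pos (a q : ℝ) (ha : a < 1) (_ha0 : 0 ≤ a) (h0 : 0 < q) (h1 : q < 1) (n : ℕ) :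
    0 < genPoch a q n := by
  refine Finset.prod_pos fun k _ => ?_
  have : q ^ k ≤ 1 := pow_le_one₀ h0.le h1.le
  have : 0 < q ^ k := by positivity
  nlinarith

lemma genPochInf_step (a q : ℝ) (h0 : 0 < q) (h1 : q < 1) :
    Multipliable (fun k : ℕ => 1 - a * q ^ k) := by
  have : Summable fun k : ℕ => -(a * q ^ k) :=
    ((summable_geometric_of_lt_one h0.le h1).mul_left a).neg
  simpa [sub_eq_add_neg] using Real.multipliable_one_add_of_summable this

lemma genPochInf_succ (a q : ℝ) (h0 : 0 < q) (h1 : q < 1) :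
    genPochInf a q = (1 - a) * genPochInf (a * q) q := by
  unfold genPochInf
  have h := genPochInf_step (a * q) q h0 h1
  have e : (fun k : ℕ => 1 - a * q * q ^ k) = fun k : ℕ => 1 - a * q ^ (k + 1) := by
    funext k; ring
  rw [e] at h ⊢
  have := tprod_eq_zero_mul' (f := fun k : ℕ => 1 - a * q ^ k) h
  simpa using this

lemma summable_aux_s14 (x y q : ℝ) (hx0 : 0 < x) (hx1 : x < 1) (hy : 0 < y) (h0 : 0 < q) (h1 : q < 1) :
    Summable fun n : ℕ => x ^ (n ^ 2) * y ^ n / genPoch q q n := by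
  have hp := genPoch_pos q q h1 h0.le h0 h1
  refine summable_of_ratio_test_tendsto_lt_one (l := 0) one_pos
    (Eventually.of_forall fun n => ?_) ?_
  · have := hp n
    positivity
  · have e : (fun n : ℕ => ‖x ^ ((n + 1) ^ 2) * y ^ (n + 1) / genPoch q q (n + 1)‖ /
        ‖x ^ (n ^ 2) * y ^ n / genPoch q q n‖) =
        fun n : ℕ => (x ^ 2) ^ n * (x * y) / (1 - q * q ^ n) := by
      funext n
      have hn := hp n
      have hn1 := hp (n + 1)
      rw [Real.norm_of_nonneg (by positivity), Real.norm_of_nonneg (by positivity)]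
      rw [genPoch_succ] at hn1 ⊢
      have h3 : 0 < 1 - q * q ^ n := pos_of_mul_pos_right hn1 hn.le
      have : x ^ ((n + 1) ^ 2) = x ^ (n ^ 2) * ((x ^ 2) ^ n * x) := by ring
      rw [this, pow_succ y]
      field_simp
    rw [e]
    have a1 : Tendsto (fun n : ℕ => (x ^ 2) ^ n) atTop (𝓝 0) :=
      tendsto_pow_atTop_nhds_zero_of_lt_one (by positivity) (by nlinarith)
    have a2 : Tendsto (fun n : ℕ => q ^ n) atTop (𝓝 0) :=
      tendsto_pow_atTop_nhds_zero_of_lt_one h0.le h1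
    have := (a1.mul_const (x * y)).div ((a2.const_mul q).const_sub 1) (by simp)
    rw [zero_mul, zero_div] at this
    exact this

/-- The Euler series. -/
noncomputable def eul (t w : ℝ) : ℝ := ∑' m : ℕ, t ^ (m ^ 2) * w ^ m / genPoch (t ^ 2) (t ^ 2) m

lemma eul_rec (t w : ℝ) (ht0 : 0 < t) (ht1 : t < 1) (hw : 0 < w) :
    eul t w = (1 + t * w) * eul t (t ^ 2 * w) := by
  have hq1 : t ^ 2 < 1 := by nlinarith
  have hq0 : 0 < t ^ 2 := by positivity
  have s1 := summable_aux_s14 t w (t ^ 2) ht0 ht1 hw hq0 hq1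
  have s2 := summable_aux_s14 t (t ^ 2 * w) (t ^ 2) ht0 ht1 (by positivity) hq0 hq1
  have hp := genPoch_pos (t ^ 2) (t ^ 2) hq1 hq0.le hq0 hq1
  have key : eul t w - eul t (t ^ 2 * w) = t * w * eul t (t ^ 2 * w) := by
    unfold eul
    rw [← s1.tsum_sub s2, (s1.sub s2).tsum_eq_zero_add, ← tsum_mul_left]
    simp only [pow_zero, sub_self, zero_add]
    refine tsum_congr fun n => ?_
    have hn := hp n
    have hn1 := hp (n + 1)
    rw [genPoch_succ] at hn1 ⊢
    have h3 : 0 < 1 - t ^ 2 * (t ^ 2) ^ n := pos_of_mul_pos_right hn1 hn.le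
    have e1 : t ^ ((n + 1) ^ 2) = t ^ (n ^ 2) * ((t ^ 2) ^ n * t) := by ring
    rw [e1, mul_pow, mul_pow, pow_succ (t ^ 2) n]
    generalize genPoch (t ^ 2) (t ^ 2) n = G at *
    generalize (t ^ 2) ^ n = Q at *
    generalize t ^ (n ^ 2) = T at *
    rw [← sub_div, div_eq_iff hn1.ne']
    have h5 : G ≠ 0 := hn.ne'
    field_simp
    ring
  linarith

lemma eul_eq (t w : ℝ) (ht0 : 0 < t) (ht1 : t < 1) (hw : 0 < w) :
    eul t w = genPochInf (-(t * w)) (t ^ 2) := by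
  have hq1 : t ^ 2 < 1 := by nlinarith
  have hq0 : 0 < t ^ 2 := by positivity
  have hp := genPoch_pos (t ^ 2) (t ^ 2) hq1 hq0.le hq0 hq1
  have hN : ∀ N : ℕ, eul t w = genPoch (-(t * w)) (t ^ 2) N * eul t ((t ^ 2) ^ N * w) := by
    intro N
    induction N with
    | zero => simp [genPoch_zero]
    | succ N ih =>
      rw [ih, eul_rec t _ ht0 ht1 (by positivity), genPoch_succ]
      have : t ^ 2 * ((t ^ 2) ^ N * w) = (t ^ 2) ^ (N + 1) * w := by ring
      rw [this]
      ring
  have l1 : Tendsto (fun N => genPoch (-(t * w)) (t ^ 2) N) atTop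
      (𝓝 (genPochInf (-(t * w)) (t ^ 2))) :=
    (genPochInf_step (-(t * w)) (t ^ 2) hq0 hq1).hasProd.tendsto_prod_nat
  have l2 : Tendsto (fun N : ℕ => eul t ((t ^ 2) ^ N * w)) atTop (𝓝 1) := by
    have hz : (1 : ℝ) = ∑' m : ℕ, if m = 0 then (1 : ℝ) else 0 := by simp
    rw [hz]
    unfold eul
    refine tendsto_tsum_of_dominated_convergence
      (summable_aux_s14 t w (t ^ 2) ht0 ht1 hw hq0 hq1) (fun m => ?_) (Eventually.of_forall fun N m => ?_)
    · have a2 : Tendsto (fun n : ℕ => (t ^ 2) ^ n) atTop (𝓝 0) :=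
        tendsto_pow_atTop_nhds_zero_of_lt_one hq0.le hq1
      have := ((((a2.mul_const w).pow m).const_mul (t ^ (m ^ 2))).div_const
        (genPoch (t ^ 2) (t ^ 2) m))
      convert this using 2
      rcases m with _ | m
      · simp [genPoch_zero]
      · simp
    · have hm := hp m
      rw [Real.norm_of_nonneg (by positivity)]
      have : (t ^ 2) ^ N * w ≤ w := by
        have : (t ^ 2) ^ N ≤ 1 := pow_le_one₀ hq0.le hq1.le
        nlinarith
      gcongr
  have l3 := l1.mul l2
  simp only [← hN, mul_one] at l3
  exact tendsto_nhds_unique tendsto_const_nhds l3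

lemma summable_nterm (t : ℝ) (ht0 : 0 < t) (ht1 : t < 1) : Summable (nterm t) := by
  have hq1 : t ^ 2 < 1 := by nlinarith
  have hq0 : 0 < t ^ 2 := by positivity
  have hp := genPoch_pos (t ^ 2) (t ^ 2) hq1 hq0.le hq0 hq1
  obtain ⟨u, hu0, hu1, rfl⟩ : ∃ u : ℝ, 0 < u ∧ u < 1 ∧ t = u ^ 2 :=
    ⟨√t, Real.sqrt_pos.2 ht0, by rw [Real.sqrt_lt' one_pos]; simpa using ht1,
      (Real.sq_sqrt ht0.le).symm⟩
  have s := summable_aux_s14 u 1 ((u ^ 2) ^ 2) hu0 hu1 one_pos hq0 hq1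
  have nn : ∀ n : ℕ, 0 ≤ u ^ (n ^ 2) * 1 ^ n / genPoch ((u ^ 2) ^ 2) ((u ^ 2) ^ 2) n := by
    intro n
    have := hp n
    positivity
  refine Summable.of_nonneg_of_le (fun p => ?_) (fun p => ?_) (s.mul_of_nonneg s nn nn)
  · have := hp p.1
    have := hp p.2
    unfold nterm
    positivity
  · obtain ⟨m, n⟩ := p
    have h1 := hp m
    have h2 := hp n
    simp only [nterm, one_pow, mul_one]
    rw [div_mul_div_comm]
    refine div_le_div_of_nonneg_right ?_ (by positivity)
    rw [div_le_iff₀ (by positivity)]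
    simp only [← pow_mul, ← pow_add]
    refine pow_le_pow_of_le_one hu0.le hu1.le ?_
    zify
    nlinarith [sq_nonneg ((m : ℤ) - n)]

lemma row_sum (t : ℝ) (ht0 : 0 < t) (ht1 : t < 1) (n : ℕ) :
    ∑' m : ℕ, (nterm t ∘ Prod.swap) (n, m) =
      t ^ (n ^ 2) / genPoch (t ^ 2) (t ^ 2) n * genPochInf (-(t * (1 / t ^ n))) (t ^ 2) := by
  rw [← eul_eq t _ ht0 ht1 (by positivity), eul, ← tsum_mul_left]
  refine tsum_congr fun m => ?_
  simp only [nterm, Function.comp, Prod.swap]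
  rw [div_pow, one_pow, ← pow_mul, mul_comm n m]
  ring

lemma inf_even (t : ℝ) (ht0 : 0 < t) (ht1 : t < 1) (k : ℕ) :
    t ^ (k ^ 2) * genPochInf (-(t * (1 / t ^ (2 * k)))) (t ^ 2) =
      genPochInf (-t) (t ^ 2) * genPoch (-t) (t ^ 2) k := by
  have hq1 : t ^ 2 < 1 := by nlinarith
  have hq0 : 0 < t ^ 2 := by positivity
  induction k with
  | zero => simp [genPoch_zero]
  | succ k ih =>
    rw [genPochInf_succ _ _ hq0 hq1, genPoch_succ, ← mul_assoc, ← mul_assoc, ← ih]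
    have : -(t * (1 / t ^ (2 * (k + 1)))) * t ^ 2 = -(t * (1 / t ^ (2 * k))) := by
      rw [mul_add, pow_add]; field_simp
    rw [this]
    generalize genPochInf (-(t * (1 / t ^ (2 * k)))) (t ^ 2) = I
    have e : t ^ ((k + 1) ^ 2) * (1 - -(t * (1 / t ^ (2 * (k + 1))))) =
        t ^ (k ^ 2) * (1 - -t * (t ^ 2) ^ k) := by
      have : t ^ ((k + 1) ^ 2) = t ^ (k ^ 2) * (t ^ (2 * k) * t) := by ring
      rw [this, mul_add 2 k 1, pow_add t (2 * k), ← pow_mul]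
      field_simp
      ring
    rw [e]
    ring

lemma inf_odd (t : ℝ) (ht0 : 0 < t) (ht1 : t < 1) (k : ℕ) :
    t ^ (k ^ 2 + k) * genPochInf (-(t * (1 / t ^ (2 * k + 1)))) (t ^ 2) =
      2 * genPochInf (-t ^ 2) (t ^ 2) * genPoch (-t ^ 2) (t ^ 2) k := by
  have hq1 : t ^ 2 < 1 := by nlinarith
  have hq0 : 0 < t ^ 2 := by positivity
  induction k with
  | zero =>
    have : -(t * (1 / t ^ (2 * 0 + 1))) = -1 := by field_simp; simp
    rw [this, genPochInf_succ _ _ hq0 hq1]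
    norm_num [genPoch_zero]
  | succ k ih =>
    rw [genPochInf_succ _ _ hq0 hq1, genPoch_succ, ← mul_assoc, ← mul_assoc, ← ih]
    have : -(t * (1 / t ^ (2 * (k + 1) + 1))) * t ^ 2 = -(t * (1 / t ^ (2 * k + 1))) := by
      rw [show 2 * (k + 1) + 1 = 2 * k + 1 + 2 by ring, pow_add t (2 * k + 1)]; field_simp
    rw [this]
    generalize genPochInf (-(t * (1 / t ^ (2 * k + 1)))) (t ^ 2) = I
    have e : t ^ ((k + 1) ^ 2 + (k + 1)) * (1 - -(t * (1 / t ^ (2 * (k + 1) + 1)))) =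
        t ^ (k ^ 2 + k) * (1 - -t ^ 2 * (t ^ 2) ^ k) := by
      have : t ^ ((k + 1) ^ 2 + (k + 1)) = t ^ (k ^ 2 + k) * (t ^ (2 * k) * t ^ 2) := by ring
      rw [this, show 2 * (k + 1) + 1 = 2 * k + 3 by ring, pow_add t (2 * k), ← pow_mul]
      field_simp
      ring
    rw [e]
    ring

lemma poch_two_mul (t : ℝ) (k : ℕ) :
    genPoch (t ^ 2) (t ^ 2) (2 * k) =
      genPoch t (t ^ 2) k * genPoch (-t) (t ^ 2) k * genPoch ((t ^ 2) ^ 2) ((t ^ 2) ^ 2) k := by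
  induction k with
  | zero => simp [genPoch_zero]
  | succ k ih =>
    rw [show 2 * (k + 1) = 2 * k + 1 + 1 by ring, genPoch_succ, genPoch_succ, ih]
    simp only [genPoch_succ]
    ring

lemma poch_two_mul_succ (t : ℝ) (k : ℕ) :
    genPoch (t ^ 2) (t ^ 2) (2 * k + 1) =
      genPoch (t ^ 2) (t ^ 2) k * genPoch (-t ^ 2) (t ^ 2) k *
        genPoch (t ^ 2) ((t ^ 2) ^ 2) (k + 1) := by
  induction k with
  | zero => simp [genPoch]
  | succ k ih =>
    rw [show 2 * (k + 1) + 1 = 2 * k + 1 + 1 + 1 by ring, genPoch_succ, genPoch_succ, ih,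
      genPoch_succ (t ^ 2) ((t ^ 2) ^ 2) (k + 1), genPoch_succ (t ^ 2) (t ^ 2) k,
      genPoch_succ (-t ^ 2) (t ^ 2) k]
    ring

lemma poch_neg_pos (a q : ℝ) (ha : 0 ≤ a) (hq : 0 < q) (n : ℕ) : 0 < genPoch (-a) q n := by
  refine Finset.prod_pos fun k _ => ?_
  have : 0 ≤ a * q ^ k := by positivity
  linarith

lemma even_row (t : ℝ) (ht0 : 0 < t) (ht1 : t < 1) (k : ℕ) :
    t ^ ((2 * k) ^ 2) / genPoch (t ^ 2) (t ^ 2) (2 * k) *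
        genPochInf (-(t * (1 / t ^ (2 * k)))) (t ^ 2) =
      genPochInf (-t) (t ^ 2) *
        (t ^ (3 * k ^ 2) / (genPoch t (t ^ 2) k * genPoch ((t ^ 2) ^ 2) ((t ^ 2) ^ 2) k)) := by
  have h := inf_even t ht0 ht1 k
  have hq1 : t ^ 2 < 1 := by nlinarith
  have hq0 : 0 < t ^ 2 := by positivity
  have p1 := poch_neg_pos t (t ^ 2) ht0.le hq0 k
  have e : t ^ ((2 * k) ^ 2) = t ^ (3 * k ^ 2) * t ^ (k ^ 2) := by ring
  rw [e, mul_div_right_comm, mul_assoc, h, poch_two_mul]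
  field_simp

lemma odd_row (t : ℝ) (ht0 : 0 < t) (ht1 : t < 1) (k : ℕ) :
    t ^ ((2 * k + 1) ^ 2) / genPoch (t ^ 2) (t ^ 2) (2 * k + 1) *
        genPochInf (-(t * (1 / t ^ (2 * k + 1)))) (t ^ 2) =
      2 * t * genPochInf (-t ^ 2) (t ^ 2) *
        (t ^ (3 * k ^ 2 + 3 * k) /
          (genPoch (t ^ 2) (t ^ 2) k * genPoch (t ^ 2) ((t ^ 2) ^ 2) (k + 1))) := by
  have h := inf_odd t ht0 ht1 k
  have hq0 : 0 < t ^ 2 := by positivity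
  have p1 := poch_neg_pos (t ^ 2) (t ^ 2) hq0.le hq0 k
  have e : t ^ ((2 * k + 1) ^ 2) = t * t ^ (3 * k ^ 2 + 3 * k) * t ^ (k ^ 2 + k) := by ring
  rw [e, mul_div_right_comm, mul_assoc, h, poch_two_mul_succ]
  field_simp

lemma sum_split (f : ℕ × ℕ → ℝ) (hf : Summable f) :
    ∑' p, f p = (∑' k : ℕ, ∑' m : ℕ, (f ∘ Prod.swap) (2 * k, m)) +
      ∑' k : ℕ, ∑' m : ℕ, (f ∘ Prod.swap) (2 * k + 1, m) := by
  have hs' : Summable (f ∘ Prod.swap) := (Equiv.prodComm ℕ ℕ).summable_iff.2 hf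
  have hswap : ∑' p, f p = ∑' p, (f ∘ Prod.swap) p :=
    ((Equiv.prodComm ℕ ℕ).tsum_eq f).symm
  have hrow := hs'.prod
  rw [hswap, hs'.tsum_prod]
  generalize f ∘ Prod.swap = g at *
  have he : Summable fun k : ℕ => ∑' m : ℕ, g (2 * k, m) :=
    hrow.comp_injective (i := fun k : ℕ => 2 * k) (fun a b h => by simpa using h)
  have ho : Summable fun k : ℕ => ∑' m : ℕ, g (2 * k + 1, m) :=
    hrow.comp_injective (i := fun k : ℕ => 2 * k + 1) (fun a b h => by simpa using h)
  exact (tsum_even_add_odd (f := fun n : ℕ => ∑' m : ℕ, g (n, m)) he ho).symm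

lemma main_aux (t : ℝ) (ht0 : 0 < t) (ht1 : t < 1) :
    ∑' p : ℕ × ℕ, nterm t p =
      genPochInf (-t) (t ^ 2) *
        (∑' k : ℕ, t ^ (3 * k ^ 2) /
          (genPoch t (t ^ 2) k * genPoch ((t ^ 2) ^ 2) ((t ^ 2) ^ 2) k)) +
      2 * t * genPochInf (-t ^ 2) (t ^ 2) *
        (∑' k : ℕ, t ^ (3 * k ^ 2 + 3 * k) /
          (genPoch (t ^ 2) (t ^ 2) k * genPoch (t ^ 2) ((t ^ 2) ^ 2) (k + 1))) := by
  rw [sum_split _ (summable_nterm t ht0 ht1), ← tsum_mul_left, ← tsum_mul_left]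
  congr 1
  · refine tsum_congr fun k => ?_
    rw [row_sum t ht0 ht1 (2 * k), even_row t ht0 ht1 k]
  · refine tsum_congr fun k => ?_
    rw [row_sum t ht0 ht1 (2 * k + 1), odd_row t ht0 ht1 k]

/-- For every `q ∈ (0,1)`:
`∑_{m,n ≥ 0} q^{½m² - ½mn + ½n²}/((q)_m (q)_n)
  = (-q^{1/2};q)_∞ ∑_{n ≥ 0} q^{(3/2)n²}/((q^{1/2};q)_n (q²;q²)_n)
    + 2 q^{1/2} (-q;q)_∞ ∑_{n ≥ 0} q^{(3/2)n² + (3/2)n}/((q)_n (q;q²)_{n+1})`. -/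
theorem nahmSum_rank_two_split (q : ℝ) (hq : q ∈ Set.Ioo (0 : ℝ) 1) :
    (∑' p : ℕ × ℕ,
        q ^ (((p.1 : ℝ)) ^ 2 / 2 - (p.1 : ℝ) * (p.2 : ℝ) / 2 + ((p.2 : ℝ)) ^ 2 / 2) /
          (genPoch q q p.1 * genPoch q q p.2)) =
      genPochInf (-(q ^ ((1 : ℝ) / 2))) q *
          (∑' n : ℕ, q ^ ((3 / 2) * ((n : ℝ)) ^ 2) /
            (genPoch (q ^ ((1 : ℝ) / 2)) q n * genPoch (q ^ 2) (q ^ 2) n)) +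
        2 * q ^ ((1 : ℝ) / 2) * genPochInf (-q) q *
          (∑' n : ℕ, q ^ ((3 / 2) * ((n : ℝ)) ^ 2 + (3 / 2) * (n : ℝ)) /
            (genPoch q q n * genPoch q (q ^ 2) (n + 1))) := by
  obtain ⟨h0, h1⟩ := hq
  obtain ⟨t, ht0, ht1, rfl⟩ : ∃ t : ℝ, 0 < t ∧ t < 1 ∧ q = t ^ 2 :=
    ⟨√q, Real.sqrt_pos.2 h0, by rw [Real.sqrt_lt' one_pos]; simpa using h1, (Real.sq_sqrt h0.le).symm⟩
  have hroot : (t ^ 2 : ℝ) ^ ((1 : ℝ) / 2) = t := by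
    rw [← Real.sqrt_eq_rpow, Real.sqrt_sq ht0.le]
  have hrp : ∀ x : ℝ, (t ^ 2 : ℝ) ^ x = t ^ (2 * x) := by
    intro x
    rw [Real.rpow_mul ht0.le]; norm_num
  have hL : ∀ p : ℕ × ℕ, (t ^ 2 : ℝ) ^ (((p.1 : ℝ)) ^ 2 / 2 - (p.1 : ℝ) * (p.2 : ℝ) / 2
        + ((p.2 : ℝ)) ^ 2 / 2) / (genPoch (t ^ 2) (t ^ 2) p.1 * genPoch (t ^ 2) (t ^ 2) p.2)
      = nterm t p := by
    intro p
    rw [hrp, nterm]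
    congr 1
    have : 2 * (((p.1 : ℝ)) ^ 2 / 2 - (p.1 : ℝ) * (p.2 : ℝ) / 2 + ((p.2 : ℝ)) ^ 2 / 2)
      = ((p.1 ^ 2 : ℕ) : ℝ) + ((p.2 ^ 2 : ℕ) : ℝ) - ((p.1 * p.2 : ℕ) : ℝ) := by
      push_cast; ring
    rw [this, Real.rpow_sub ht0, Real.rpow_add ht0, Real.rpow_natCast, Real.rpow_natCast,
      Real.rpow_natCast]
  have hR1 : ∀ n : ℕ, (t ^ 2 : ℝ) ^ ((3 / 2) * ((n : ℝ)) ^ 2) = t ^ (3 * n ^ 2) := by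
    intro n
    rw [hrp, ← Real.rpow_natCast t (3 * n ^ 2)]
    congr 1; push_cast; ring
  have hR2 : ∀ n : ℕ, (t ^ 2 : ℝ) ^ ((3 / 2) * ((n : ℝ)) ^ 2 + (3 / 2) * (n : ℝ))
      = t ^ (3 * n ^ 2 + 3 * n) := by
    intro n
    rw [hrp, ← Real.rpow_natCast t (3 * n ^ 2 + 3 * n)]
    congr 1; push_cast; ring
  simp only [hL, hR1, hR2, hroot]
  exact main_aux t ht0 ht1
end

section
/- Let A be the 4×4 matrix with rows (3,1,1,0), (1,3,0,1), (1,0,1,0), (0,1,0,1) and let B = (1/2, −1/2, 1/2, 1/2). Then for every complex q with |q| < 1: ∑_{n ∈ (ℤ_{≥0})⁴} q^{(1/2)nᵀAn + nᵀB} / ((q)_{n₁}(q)_{n₂}(q)_{n₃}(q)_{n₄}) = ((q²;q²)_∞² / (q;q)_∞³) · ∑_{k ∈ ℤ} (−1)^k q^{(5k²+k)/2}. Equivalently, with C = 1/15, F_{A,B,C}(e^{2πiz}) = η(2z)²·θ_{5,1}(z)/η(z)³, where η(z) = q^{1/24}∏_{n≥1}(1−q^n) and θ_{5,1}(z) = ∑_{n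 ≡ 1 (mod 10)} (−1)^{⌊n/10⌋} q^{n²/40} with q = e^{2πiz}. -/
/-- The `q`-Pochhammer symbol `(q;q)_n = ∏_{k=1}^n (1 - q^k)` (complex `q`). -/
noncomputable def qPochC (q : ℂ) (n : ℕ) : ℂ := ∏ k ∈ Finset.range n, (1 - q ^ (k + 1))

/-- The infinite `q`-Pochhammer symbol `(q;q)_∞ = ∏_{k=1}^∞ (1 - q^k)` (complex `q`). -/
noncomputable def qPochInfC (q : ℂ) : ℂ := ∏' k : ℕ, (1 - q ^ (k + 1))


namespace RRNahm

open Filter Topology Finset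

/-- The triangular number `k (k - 1) / 2`. -/
def tri (k : ℤ) : ℤ := k * (k - 1) / 2

lemma two_tri (k : ℤ) : 2 * tri k = k * (k - 1) := by
  unfold tri
  apply Int.mul_ediv_cancel'
  have := Int.even_mul_pred_self k
  exact this.two_dvd

lemma tri_succ (k : ℤ) : tri (k + 1) = tri k + k := by
  have h1 := two_tri k
  have h2 := two_tri (k + 1)
  linarith

lemma tri_neg (k : ℤ) : tri (-k) = tri k + k := by
  have h1 := two_tri k
  have h2 := two_tri (-k)
  linarith

lemma tri_zero : tri 0 = 0 := by simp [tri]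

/-- `1 / (q;q)_n`, extended by zero to negative `n`. -/
noncomputable def u (q : ℂ) (n : ℤ) : ℂ := if 0 ≤ n then (qPochC q n.toNat)⁻¹ else 0

lemma u_nat (q : ℂ) (n : ℕ) : u q n = (qPochC q n)⁻¹ := by simp [u]

lemma u_neg (q : ℂ) (n : ℤ) (h : n < 0) : u q n = 0 := by simp [u, not_le.mpr h]

lemma u_zero (q : ℂ) : u q 0 = 1 := by simp [u, qPochC]

lemma one_sub_pow_ne {q : ℂ} (hq : ‖q‖ < 1) (n : ℕ) : 1 - q ^ (n + 1) ≠ 0 := by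
  intro h
  have h1 : q ^ (n + 1) = 1 := (sub_eq_zero.mp h).symm
  have h2 : ‖q‖ ^ (n + 1) = 1 := by rw [← norm_pow, h1, norm_one]
  have h3 : ‖q‖ ^ (n + 1) < 1 := pow_lt_one₀ (norm_nonneg _) hq (by omega)
  linarith

lemma qPochC_ne {q : ℂ} (hq : ‖q‖ < 1) (n : ℕ) : qPochC q n ≠ 0 :=
  Finset.prod_ne_zero_iff.mpr fun k _ => one_sub_pow_ne hq k

lemma qPochC_succ (q : ℂ) (n : ℕ) : qPochC q (n + 1) = qPochC q n * (1 - q ^ (n + 1)) := by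
  simp [qPochC, Finset.prod_range_succ]

lemma inv_rec {q : ℂ} (hq : ‖q‖ < 1) (n : ℕ) :
    (1 - q ^ (n + 1)) * (qPochC q (n + 1))⁻¹ = (qPochC q n)⁻¹ := by
  rw [qPochC_succ]
  have := one_sub_pow_ne hq n
  have := qPochC_ne hq n
  field_simp

lemma u_rec {q : ℂ} (hq : ‖q‖ < 1) (n : ℤ) : (1 - q ^ n) * u q n = u q (n - 1) := by
  rcases lt_trichotomy n 0 with h | h | h
  · rw [u_neg q n h, u_neg q (n - 1) (by omega)]; simp
  · subst h; rw [u_neg q (0 - 1) (by omega)]; simp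
  · obtain ⟨m, rfl⟩ : ∃ m : ℕ, n = (m : ℤ) + 1 := ⟨(n - 1).toNat, by omega⟩
    have := inv_rec hq m
    rw [show ((m : ℤ) + 1) = ((m + 1 : ℕ) : ℤ) by push_cast; ring, u_nat,
      show (((m + 1 : ℕ) : ℤ) - 1) = (m : ℤ) by push_cast; ring, u_nat, zpow_natCast]
    exact this

lemma one_sub_zpow_ne {q : ℂ} (hq : ‖q‖ < 1) (n : ℤ) (hn : 0 < n) : 1 - q ^ n ≠ 0 := by
  obtain ⟨m, rfl⟩ : ∃ m : ℕ, n = ((m + 1 : ℕ) : ℤ) := ⟨(n - 1).toNat, by omega⟩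
  rw [zpow_natCast]; exact one_sub_pow_ne hq m

/-- Finite q-Vandermonde. -/
lemma core_nat {q : ℂ} (hq : ‖q‖ < 1) (h0 : q ≠ 0) (m : ℕ) : ∀ L : ℕ,
    ∑ i ∈ range (m + 1), q ^ ((i : ℤ) * (i + L)) * u q (m - i) * u q i * u q (i + L)
      = u q m * u q (m + L) := by
  induction m with
  | zero => intro L; simp [u_zero]
  | succ m ih =>
    intro L
    have hne := one_sub_zpow_ne hq ((m : ℤ) + 1) (by omega)
    apply mul_left_cancel₀ hne
    have e1 := ih L
    have e2 := ih (L + 1)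
    have key : ∀ i : ℕ, (1 - q ^ ((m : ℤ) + 1)) *
        (q ^ ((i : ℤ) * (i + L)) * u q ((m + 1 : ℕ) - i) * u q i * u q (i + L)) =
        q ^ ((i : ℤ) * (i + L)) * u q (m - i) * u q i * u q (i + L) +
        q ^ ((i : ℤ) * (i + L) + (m + 1 - i)) * u q ((m + 1 : ℕ) - i) * u q (i - 1)
          * u q (i + L) := by
      intro i
      have a1 := u_rec hq ((m + 1 : ℕ) - i : ℤ)
      rw [show (((m + 1 : ℕ) : ℤ) - i - 1) = m - i by push_cast; ring] at a1
      have a2 := u_rec hq (i : ℤ)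
      rw [← a1, ← a2, zpow_add₀ h0 ((i : ℤ) * (i + L))]
      have : q ^ ((m : ℤ) + 1) = q ^ ((m : ℤ) + 1 - i) * q ^ (i : ℤ) := by
        rw [← zpow_add₀ h0]; congr 1; ring
      rw [this, show (((m + 1 : ℕ) : ℤ) - i) = (m : ℤ) + 1 - i by push_cast; ring]
      ring
    rw [Finset.mul_sum, Finset.sum_congr rfl (fun i _ => key i), Finset.sum_add_distrib]
    rw [Finset.sum_range_succ, e1]
    rw [u_neg q ((m : ℤ) - (m + 1 : ℕ)) (by push_cast; omega)]
    rw [Finset.sum_range_succ']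
    rw [u_neg q (((0 : ℕ) : ℤ) - 1) (by simp)]
    have e3 : ∑ i ∈ range (m + 1), q ^ (((i + 1 : ℕ) : ℤ) * ((i + 1 : ℕ) + L) +
          (m + 1 - (i + 1 : ℕ))) * u q ((m + 1 : ℕ) - (i + 1 : ℕ)) * u q ((i + 1 : ℕ) - 1)
          * u q ((i + 1 : ℕ) + L) = q ^ ((m : ℤ) + 1 + L) * (u q m * u q (m + (L + 1 : ℕ))) := by
      rw [← e2, Finset.mul_sum]
      apply Finset.sum_congr rfl
      intro i _
      rw [show (((i + 1 : ℕ) : ℤ) * ((i + 1 : ℕ) + L) + (m + 1 - (i + 1 : ℕ))) =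
        ((m : ℤ) + 1 + L) + ((i : ℤ) * (i + (L + 1 : ℕ))) by push_cast; ring, zpow_add₀ h0,
        show (((m + 1 : ℕ) : ℤ) - (i + 1 : ℕ)) = m - i by push_cast; ring,
        show (((i + 1 : ℕ) : ℤ) - 1) = i by push_cast; ring,
        show (((i + 1 : ℕ) : ℤ) + L) = i + (L + 1 : ℕ) by push_cast; ring]
      ring
    rw [e3]
    have b1 := u_rec hq ((m : ℤ) + 1 + L)
    have b2 := u_rec hq ((m : ℤ) + 1)
    rw [show ((m : ℤ) + 1 + L - 1) = m + L by ring] at b1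
    rw [show ((m : ℤ) + 1 - 1) = m by ring] at b2
    rw [show ((m : ℤ) + (L + 1 : ℕ)) = m + 1 + L by push_cast; ring, ← b1,
      show ((m + 1 : ℕ) : ℤ) = m + 1 by push_cast; ring, ← b2]
    ring

lemma core_k {q : ℂ} (hq : ‖q‖ < 1) (h0 : q ≠ 0) (n k : ℕ) :
    ∑ j ∈ range (n + 1), q ^ ((j : ℤ) ^ 2) * u q (n - j) * (u q (j - k) * u q (j + k))
      = q ^ ((k : ℤ) ^ 2) * (u q (n - k) * u q (n + k)) := by
  by_cases h : n < k
  · rw [u_neg q ((n : ℤ) - k) (by omega)]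
    simp only [zero_mul, mul_zero]
    apply Finset.sum_eq_zero
    intro j hj
    have := Finset.mem_range.mp hj
    rw [u_neg q ((j : ℤ) - k) (by omega)]
    simp
  · obtain ⟨m, rfl⟩ : ∃ m, n = k + m := ⟨n - k, by omega⟩
    rw [add_assoc, Finset.sum_range_add]
    rw [Finset.sum_eq_zero, zero_add]
    · have := core_nat hq h0 m (2 * k)
      rw [show (((k + m : ℕ) : ℤ) - k) = m by push_cast; ring,
        show (((k + m : ℕ) : ℤ) + k) = m + (2 * k : ℕ) by push_cast; ring, ← this,
        Finset.mul_sum]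
      apply Finset.sum_congr rfl
      intro i _
      rw [show (((k + m : ℕ) : ℤ) - (k + i : ℕ)) = m - i by push_cast; ring,
        show (((k + i : ℕ) : ℤ) - k) = i by push_cast; ring,
        show (((k + i : ℕ) : ℤ) + k) = i + (2 * k : ℕ) by push_cast; ring,
        show (((k + i : ℕ) : ℤ) ^ 2) = (k : ℤ) ^ 2 + (i : ℤ) * (i + (2 * k : ℕ)) by
          push_cast; ring, zpow_add₀ h0]
      ring
    · intro j hj
      have := Finset.mem_range.mp hj
      rw [u_neg q ((j : ℤ) - k) (by omega)]
      simp

lemma core_int {q : ℂ} (hq : ‖q‖ < 1) (h0 : q ≠ 0) (n : ℕ) (k : ℤ) :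
    ∑ j ∈ range (n + 1), q ^ ((j : ℤ) ^ 2) * u q (n - j) * (u q (j - k) * u q (j + k))
      = q ^ (k ^ 2) * (u q (n - k) * u q (n + k)) := by
  obtain ⟨m, rfl | rfl⟩ := Int.eq_nat_or_neg k
  · exact core_k hq h0 n m
  · have := core_k hq h0 n m
    simp only [sub_neg_eq_add, ← sub_eq_add_neg, neg_sq]
    simpa only [mul_comm (u q (_ + (m : ℤ)))] using this

/-- One step of Bailey's lemma. -/
lemma bailey {q : ℂ} (hq : ‖q‖ < 1) (h0 : q ≠ 0) (N : Finset ℤ) (n : ℕ) (α : ℤ → ℂ) :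
    ∑ j ∈ range (n + 1), q ^ ((j : ℤ) ^ 2) * u q (n - j) *
      (∑ k ∈ N, α k * (u q (j - k) * u q (j + k)))
      = ∑ k ∈ N, α k * q ^ (k ^ 2) * (u q (n - k) * u q (n + k)) := by
  simp only [Finset.mul_sum]
  rw [Finset.sum_comm]
  apply Finset.sum_congr rfl
  intro k _
  rw [mul_assoc, ← core_int hq h0 n k, Finset.mul_sum]
  apply Finset.sum_congr rfl
  intro j _
  ring

lemma telesc (f : ℤ → ℂ) (N : ℕ) :
    ∑ k ∈ Finset.Icc (-(N : ℤ)) N, (f k - f (k + 1)) = f (-N) - f (N + 1) := by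
  induction N with
  | zero => simp
  | succ N ih =>
    have : Finset.Icc (-((N + 1 : ℕ) : ℤ)) ((N + 1 : ℕ) : ℤ) =
        insert (-((N : ℤ) + 1)) (insert ((N : ℤ) + 1) (Finset.Icc (-(N : ℤ)) N)) := by
      ext x; simp only [Finset.mem_Icc, Finset.mem_insert]; push_cast; omega
    rw [this, Finset.sum_insert, Finset.sum_insert, ih]
    · push_cast
      rw [show (-((N : ℤ) + 1) + 1) = -N by ring]
      ring
    · simp
    · simp only [Finset.mem_Icc, Finset.mem_insert]; omega

lemma sum_neg_symm (f : ℤ → ℂ) (N : ℕ) :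
    ∑ k ∈ Finset.Icc (-(N : ℤ)) N, f (-k) = ∑ k ∈ Finset.Icc (-(N : ℤ)) N, f k := by
  apply Finset.sum_bij' (fun k _ => -k) (fun k _ => -k) <;> simp <;> omega

/-- The unit Bailey pair. -/
lemma unit_pair {q : ℂ} (hq : ‖q‖ < 1) (h0 : q ≠ 0) (N n : ℕ) (hn : n ≤ N) :
    ∑ k ∈ Finset.Icc (-(N : ℤ)) N, (-1 : ℂ) ^ k * q ^ tri k * (u q (n - k) * u q (n + k))
      = if n = 0 then 1 else 0 := by
  have m1 : (-1 : ℂ) ≠ 0 := by norm_num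
  split_ifs with h
  · subst h
    rw [Finset.sum_eq_single 0]
    · simp [tri_zero, u_zero]
    · intro k _ hk
      rcases lt_or_gt_of_ne hk with h | h
      · rw [u_neg q (((0 : ℕ) : ℤ) + k) (by simpa using h)]; simp
      · rw [u_neg q (((0 : ℕ) : ℤ) - k) (by simpa using h)]; simp
    · intro h; exfalso; apply h; simp
  · set S := ∑ k ∈ Finset.Icc (-(N : ℤ)) N,
      (-1 : ℂ) ^ k * q ^ tri k * (u q (n - k) * u q (n + k)) with hS
    have hS' : S = ∑ k ∈ Finset.Icc (-(N : ℤ)) N,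
        (-1 : ℂ) ^ k * q ^ (tri k + k) * (u q (n - k) * u q (n + k)) := by
      rw [hS, ← sum_neg_symm]
      apply Finset.sum_congr rfl
      intro k _
      rw [tri_neg, sub_neg_eq_add, ← sub_eq_add_neg, zpow_neg, ← inv_zpow]
      rw [inv_neg_one]
      ring
    have hT := telesc (fun k => (-1 : ℂ) ^ k * q ^ tri k * (u q (n - k) * u q (n + k - 1))) N
    rw [u_neg q ((n : ℤ) + -N - 1) (by omega), u_neg q ((n : ℤ) - (N + 1)) (by omega)] at hT
    simp only [zero_mul, mul_zero, sub_zero] at hT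
    have h2 : (1 - q ^ (n : ℤ)) * (S + S) = 0 := by
      rw [← hT]
      nth_rewrite 2 [hS']
      rw [hS, ← Finset.sum_add_distrib, Finset.mul_sum]
      apply Finset.sum_congr rfl
      intro k _
      have b1 := u_rec hq ((n : ℤ) - k)
      have b2 := u_rec hq ((n : ℤ) + k)
      rw [show ((n : ℤ) - (k + 1)) = n - k - 1 by ring, ← b1, ← b2,
        show ((n : ℤ) + (k + 1) - 1) = n + k by ring, tri_succ, zpow_add₀ h0, zpow_add₀ m1,
        zpow_sub₀ h0, zpow_add₀ h0]
      have := zpow_ne_zero k h0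
      field_simp
      ring
    rcases mul_eq_zero.mp h2 with h3 | h3
    · exact absurd h3 (one_sub_zpow_ne hq n (by omega))
    · have : 2 * S = 0 := by rw [two_mul]; exact h3
      simpa using this

lemma rr_finite {q : ℂ} (hq : ‖q‖ < 1) (h0 : q ≠ 0) (n : ℕ) :
    ∑ j ∈ range (n + 1), q ^ ((j : ℤ) ^ 2) * u q (n - j) * u q j
      = ∑ k ∈ Finset.Icc (-(n : ℤ)) n,
        (-1 : ℂ) ^ k * q ^ (tri k + 2 * k ^ 2) * (u q (n - k) * u q (n + k)) := by
  have step1 : ∀ m ∈ range (n + 1), u q m = ∑ k ∈ Finset.Icc (-(n : ℤ)) n,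
      (-1 : ℂ) ^ k * q ^ tri k * q ^ (k ^ 2) * (u q (m - k) * u q (m + k)) := by
    intro m hm
    have hm' := Finset.mem_range.mp hm
    rw [← bailey hq h0 _ m (fun k => (-1 : ℂ) ^ k * q ^ tri k)]
    rw [Finset.sum_eq_single 0]
    · rw [unit_pair hq h0 n 0 (by omega)]; simp
    · intro j hj hj0
      have := Finset.mem_range.mp hj
      rw [unit_pair hq h0 n j (by omega)]; simp [hj0]
    · simp
  rw [Finset.sum_congr rfl (fun m hm => by rw [step1 m hm])]
  rw [bailey hq h0 _ n (fun k => (-1 : ℂ) ^ k * q ^ tri k * q ^ (k ^ 2))]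
  apply Finset.sum_congr rfl
  intro k _
  rw [zpow_add₀ h0, two_mul, zpow_add₀ h0]
  ring

/-- The exponent of the double sum. -/
def ex (a b : ℤ) : ℤ := tri (a + 1) + a ^ 2 + tri b + b ^ 2 + a * b

lemma ex_swap (a b : ℤ) : ex b a = ex a b + b - a := by
  unfold ex; rw [tri_succ, tri_succ]; ring

lemma antidiag_sum {q : ℂ} (hq : ‖q‖ < 1) (h0 : q ≠ 0) (M : ℕ) :
    ∑ p ∈ antidiagonal M, q ^ ex p.1 p.2 * ((qPochC (q ^ 2) p.1)⁻¹ * (qPochC (q ^ 2) p.2)⁻¹)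
      = q ^ ((M : ℤ) ^ 2) * (qPochC q M)⁻¹ := by
  have hq2 : ‖q ^ 2‖ < 1 := by
    rw [norm_pow]; exact pow_lt_one₀ (norm_nonneg _) hq (by norm_num)
  induction M with
  | zero => simp [ex, tri, qPochC]
  | succ M ih =>
    set w : ℕ → ℂ := fun a => (qPochC (q ^ 2) a)⁻¹ with hw
    have wrec : ∀ a : ℕ, (1 - q ^ (2 * ((a : ℤ) + 1))) * w (a + 1) = w a := by
      intro a
      have := inv_rec hq2 a
      rw [← pow_mul, ← zpow_natCast] at this
      push_cast at this
      exact this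
    have hne : (1 - q ^ (2 * ((M : ℤ) + 1))) ≠ 0 := one_sub_zpow_ne hq _ (by omega)
    have hne' : (1 - q ^ ((M : ℤ) + 1)) ≠ 0 := one_sub_zpow_ne hq _ (by omega)
    apply mul_left_cancel₀ hne
    have split : (1 - q ^ (2 * ((M : ℤ) + 1))) *
        ∑ p ∈ antidiagonal (M + 1), q ^ ex p.1 p.2 * (w p.1 * w p.2) =
        ∑ p ∈ antidiagonal (M + 1), q ^ ex p.1 p.2 * (w p.1 * ((1 - q ^ (2 * (p.2 : ℤ))) * w p.2))
        + ∑ p ∈ antidiagonal (M + 1),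
          q ^ (ex p.1 p.2 + 2 * p.2) * (((1 - q ^ (2 * (p.1 : ℤ))) * w p.1) * w p.2) := by
      rw [← Finset.sum_add_distrib, Finset.mul_sum]
      apply Finset.sum_congr rfl
      intro p hp
      have hp' : (p.1 : ℤ) + p.2 = M + 1 := by exact_mod_cast Finset.HasAntidiagonal.mem_antidiagonal.mp hp
      rw [← hp', mul_add, zpow_add₀ h0, zpow_add₀ h0]
      ring
    rw [split, Finset.Nat.sum_antidiagonal_succ', Finset.Nat.sum_antidiagonal_succ]
    simp only [Nat.cast_zero, mul_zero, zpow_zero, sub_self, zero_mul, zero_add]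
    push_cast
    simp only [wrec]
    have s1 : ∑ p ∈ antidiagonal M, q ^ ex p.1 (p.2 + 1) * (w p.1 * w p.2) =
        q ^ (2 * (M : ℤ) + 1) * ∑ p ∈ antidiagonal M, q ^ ex p.1 p.2 * (w p.1 * w p.2) := by
      rw [← Finset.Nat.sum_antidiagonal_swap, Finset.mul_sum]
      apply Finset.sum_congr rfl
      intro p hp
      have hp' : (p.1 : ℤ) + p.2 = M := by exact_mod_cast Finset.HasAntidiagonal.mem_antidiagonal.mp hp
      simp only [Prod.fst_swap, Prod.snd_swap]
      have : ex p.2 (p.1 + 1) = (2 * (M : ℤ) + 1) + ex p.1 p.2 := by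
        rw [← hp']; unfold ex; simp only [tri_succ]; ring
      rw [this, zpow_add₀ h0]
      ring
    have s2 : ∑ p ∈ antidiagonal M, q ^ (ex (p.1 + 1) p.2 + 2 * p.2) * (w p.1 * w p.2) =
        q ^ (3 * (M : ℤ) + 2) * ∑ p ∈ antidiagonal M, q ^ ex p.1 p.2 * (w p.1 * w p.2) := by
      rw [Finset.mul_sum]
      apply Finset.sum_congr rfl
      intro p hp
      have hp' : (p.1 : ℤ) + p.2 = M := by exact_mod_cast Finset.HasAntidiagonal.mem_antidiagonal.mp hp
      have : ex (p.1 + 1) p.2 + 2 * p.2 = (3 * (M : ℤ) + 2) + ex p.1 p.2 := by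
        rw [← hp']; unfold ex; simp only [tri_succ]; ring
      rw [this, zpow_add₀ h0]
      ring
    rw [s1, s2, ih, ← inv_rec hq M]
    have z1 : q ^ (3 * (M : ℤ) + 2) = q ^ (2 * (M : ℤ) + 1) * q ^ ((M : ℤ) + 1) := by
      rw [← zpow_add₀ h0]; congr 1; ring
    have z2 : q ^ (((M : ℤ) + 1) ^ 2) = q ^ (2 * (M : ℤ) + 1) * q ^ ((M : ℤ) ^ 2) := by
      rw [← zpow_add₀ h0]; congr 1; ring
    have z3 : q ^ (2 * ((M : ℤ) + 1)) = q ^ ((M : ℤ) + 1) * q ^ ((M : ℤ) + 1) := by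
      rw [← zpow_add₀ h0]; congr 1; ring
    have z4 : q ^ (M + 1) = q ^ ((M : ℤ) + 1) := by
      rw [← zpow_natCast]; push_cast; rfl
    rw [z1, z2, z3, z4]
    ring

lemma tendsto_poch {q : ℂ} (hq : ‖q‖ < 1) : Tendsto (qPochC q) atTop (𝓝 (qPochInfC q)) :=
  (ModularForm.multipliable_one_sub_pow hq).hasProd.tendsto_prod_nat

lemma pochInf_ne {q : ℂ} (hq : ‖q‖ < 1) : qPochInfC q ≠ 0 := by
  unfold qPochInfC
  simp only [sub_eq_add_neg]
  refine tprod_one_add_ne_zero_of_summable (f := fun n => -q ^ (n + 1)) ?_ ?_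
  · intro n; simpa [sub_eq_add_neg] using one_sub_pow_ne hq n
  · simp only [norm_neg, norm_pow]
    exact (summable_nat_add_iff 1).mpr (summable_geometric_of_lt_one (norm_nonneg _) hq)

lemma tendsto_u {q : ℂ} (hq : ‖q‖ < 1) : Tendsto (u q) atTop (𝓝 (qPochInfC q)⁻¹) := by
  have h1 : Tendsto (fun n : ℤ => (qPochC q n.toNat)⁻¹) atTop (𝓝 (qPochInfC q)⁻¹) :=
    ((tendsto_poch hq).inv₀ (pochInf_ne hq)).comp
      (tendsto_atTop_atTop.mpr fun b => ⟨b, fun a ha => by omega⟩)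
  apply h1.congr'
  filter_upwards [eventually_ge_atTop 0] with n hn
  simp [u, hn]

lemma u_bound {q : ℂ} (hq : ‖q‖ < 1) : ∃ M : ℝ, 0 ≤ M ∧ ∀ n : ℤ, ‖u q n‖ ≤ M := by
  have h1 := (tendsto_poch hq).inv₀ (pochInf_ne hq)
  obtain ⟨M, hM⟩ := (Metric.isBounded_range_of_tendsto _ h1).exists_norm_le
  have hM0 : 0 ≤ M := le_trans (norm_nonneg _) (hM _ ⟨0, rfl⟩)
  refine ⟨M, hM0, fun n => ?_⟩
  unfold u
  split_ifs with h
  · exact hM _ ⟨n.toNat, rfl⟩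
  · simpa using hM0

lemma norm_zpow_le {q : ℂ} (hq : ‖q‖ < 1) (h0 : q ≠ 0) (e : ℤ) (n : ℕ) (h : (n : ℤ) ≤ e) :
    ‖q ^ e‖ ≤ ‖q‖ ^ n := by
  rw [norm_zpow, ← zpow_natCast]
  exact zpow_le_zpow_right_of_le_one₀ (norm_pos_iff.mpr h0) hq.le h

lemma tendsto_u_sub {q : ℂ} (hq : ‖q‖ < 1) (k : ℤ) :
    Tendsto (fun n : ℕ => u q (n - k)) atTop (𝓝 (qPochInfC q)⁻¹) := by
  apply (tendsto_u hq).comp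
  exact tendsto_atTop_add_const_right _ (-k) tendsto_natCast_atTop_atTop

lemma tendsto_u_add {q : ℂ} (hq : ‖q‖ < 1) (k : ℤ) :
    Tendsto (fun n : ℕ => u q (n + k)) atTop (𝓝 (qPochInfC q)⁻¹) := by
  apply (tendsto_u hq).comp
  exact tendsto_atTop_add_const_right _ k tendsto_natCast_atTop_atTop

lemma tri_nonneg (k : ℤ) : 0 ≤ tri k := by
  have h := two_tri k
  have : 0 ≤ k * (k - 1) := by
    rcases le_or_gt k 0 with h | h
    · nlinarith
    · nlinarith
  omega

lemma abs_le_sq (k : ℤ) : (k.natAbs : ℤ) ≤ k ^ 2 := by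
  have : (k.natAbs : ℤ) ^ 2 = k ^ 2 := Int.natAbs_sq k
  rw [← this]
  have h : k.natAbs ≤ k.natAbs ^ 2 := Nat.le_self_pow (by norm_num) _
  exact_mod_cast h

lemma summable_natAbs {r : ℝ} (h0 : 0 ≤ r) (h : r < 1) : Summable fun k : ℤ => r ^ k.natAbs := by
  apply Summable.of_nat_of_neg <;> simpa using summable_geometric_of_lt_one h0 h

/-- The first Rogers-Ramanujan identity. -/
lemma rr {q : ℂ} (hq : ‖q‖ < 1) (h0 : q ≠ 0) :
    ∑' j : ℕ, q ^ ((j : ℤ) ^ 2) * u q j =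
      (qPochInfC q)⁻¹ * ∑' k : ℤ, (-1 : ℂ) ^ k * q ^ (tri k + 2 * k ^ 2) := by
  obtain ⟨M, hM0, hM⟩ := u_bound hq
  set P := qPochInfC q
  have hP : P ≠ 0 := pochInf_ne hq
  have t1 : Tendsto (fun n : ℕ => ∑' j : ℕ, q ^ ((j : ℤ) ^ 2) * u q (n - j) * u q j) atTop
      (𝓝 (∑' j : ℕ, q ^ ((j : ℤ) ^ 2) * P⁻¹ * u q j)) := by
    apply tendsto_tsum_of_dominated_convergence (bound := fun j => ‖q‖ ^ j * M * M)
    · exact ((summable_geometric_of_lt_one (norm_nonneg _) hq).mul_right _).mul_right _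
    · intro j
      exact ((tendsto_u_sub hq j).const_mul _).mul_const _
    · filter_upwards with n j
      rw [norm_mul, norm_mul]
      have := norm_zpow_le hq h0 ((j : ℤ) ^ 2) j (by simpa using abs_le_sq j)
      gcongr
      · exact hM _
      · exact hM _
  have t2 : Tendsto (fun n : ℕ => ∑' k : ℤ, (-1 : ℂ) ^ k * q ^ (tri k + 2 * k ^ 2) *
        (u q (n - k) * u q (n + k))) atTop
      (𝓝 (∑' k : ℤ, (-1 : ℂ) ^ k * q ^ (tri k + 2 * k ^ 2) * (P⁻¹ * P⁻¹))) := by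
    apply tendsto_tsum_of_dominated_convergence (bound := fun k => ‖q‖ ^ k.natAbs * (M * M))
    · exact (summable_natAbs (norm_nonneg _) hq).mul_right _
    · intro k
      exact ((tendsto_u_sub hq k).mul (tendsto_u_add hq k)).const_mul _
    · filter_upwards with n k
      rw [norm_mul, norm_mul, norm_mul, norm_zpow (-1 : ℂ), norm_neg, norm_one, one_zpow, one_mul]
      have := norm_zpow_le hq h0 (tri k + 2 * k ^ 2) k.natAbs (by
        have := abs_le_sq k; have := tri_nonneg k; nlinarith)
      gcongr
      · exact hM _
      · exact hM _
  have heq : ∀ n : ℕ, ∑' j : ℕ, q ^ ((j : ℤ) ^ 2) * u q (n - j) * u q j =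
      ∑' k : ℤ, (-1 : ℂ) ^ k * q ^ (tri k + 2 * k ^ 2) * (u q (n - k) * u q (n + k)) := by
    intro n
    rw [tsum_eq_sum (s := range (n + 1)), tsum_eq_sum (s := Finset.Icc (-(n : ℤ)) n)]
    · exact rr_finite hq h0 n
    · intro k hk
      rw [Finset.mem_Icc, not_and_or] at hk
      rcases hk with h | h
      · rw [u_neg q ((n : ℤ) + k) (by omega)]; simp
      · rw [u_neg q ((n : ℤ) - k) (by omega)]; simp
    · intro j hj
      rw [Finset.mem_range] at hj
      rw [u_neg q ((n : ℤ) - j) (by omega)]; simp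
  simp only [heq] at t1
  have := tendsto_nhds_unique t1 t2
  rw [tsum_mul_right] at this
  simp only [mul_right_comm _ P⁻¹] at this
  rw [tsum_mul_right] at this
  apply mul_right_cancel₀ (inv_ne_zero hP)
  rw [this]
  ring

/-- Terms of Euler's series. -/
noncomputable def ef (q : ℂ) (a c : ℕ) : ℂ := q ^ (tri (c + 1) + a * c) * u q c

lemma tri_succ_ge (c : ℕ) : (c : ℤ) ≤ tri (c + 1) := by
  have h := two_tri ((c : ℤ) + 1)
  have := abs_le_sq c
  simp only [Int.natAbs_natCast] at this
  nlinarith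

lemma ef_bound {q : ℂ} (hq : ‖q‖ < 1) (h0 : q ≠ 0) {M : ℝ} (hM : ∀ n : ℤ, ‖u q n‖ ≤ M)
    (a c : ℕ) : ‖ef q a c‖ ≤ ‖q‖ ^ c * M := by
  unfold ef
  rw [norm_mul]
  have := norm_zpow_le hq h0 (tri (c + 1) + a * c) c (by
    have := tri_succ_ge c; have : (0 : ℤ) ≤ a * c := by positivity
    linarith)
  gcongr
  exact hM _

lemma ef_summable {q : ℂ} (hq : ‖q‖ < 1) (h0 : q ≠ 0) (a : ℕ) :
    Summable fun c => ‖ef q a c‖ := by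
  obtain ⟨M, hM0, hM⟩ := u_bound hq
  exact Summable.of_nonneg_of_le (fun _ => norm_nonneg _) (ef_bound hq h0 hM a)
    ((summable_geometric_of_lt_one (norm_nonneg _) hq).mul_right M)

lemma ef_rec {q : ℂ} (hq : ‖q‖ < 1) (h0 : q ≠ 0) (a : ℕ) :
    ∑' c, ef q a c = (1 + q ^ (a + 1)) * ∑' c, ef q (a + 1) c := by
  have s1 := (ef_summable hq h0 a).of_norm
  have s2 := (ef_summable hq h0 (a + 1)).of_norm
  have h := s1.tsum_sub s2
  have hs := s1.sub s2
  rw [hs.tsum_eq_zero_add] at h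
  have e0 : ef q a 0 - ef q (a + 1) 0 = 0 := by simp [ef]
  have e1 : ∀ c : ℕ, ef q a (c + 1) - ef q (a + 1) (c + 1) = q ^ (a + 1) * ef q (a + 1) c := by
    intro c
    have := u_rec hq ((c + 1 : ℕ) : ℤ)
    rw [show (((c + 1 : ℕ) : ℤ) - 1) = c by push_cast; ring] at this
    unfold ef
    rw [← this]
    have z1 : q ^ (tri ((c + 1 : ℕ) + 1) + ((a + 1 : ℕ) : ℤ) * (c + 1 : ℕ)) =
        q ^ (tri ((c + 1 : ℕ) + 1) + (a : ℤ) * (c + 1 : ℕ)) * q ^ ((c + 1 : ℕ) : ℤ) := by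
      rw [← zpow_add₀ h0]; congr 1; push_cast; ring
    have z2 : q ^ (tri ((c + 1 : ℕ) + 1) + (a : ℤ) * (c + 1 : ℕ)) =
        q ^ (a + 1) * q ^ (tri (c + 1) + ((a + 1 : ℕ) : ℤ) * c) := by
      rw [← zpow_natCast, ← zpow_add₀ h0, tri_succ]; congr 1; push_cast; ring
    rw [z1, z2]
    ring
  simp only [e0, e1, tsum_mul_left, zero_add] at h
  linear_combination -h

lemma ef_prod {q : ℂ} (hq : ‖q‖ < 1) (h0 : q ≠ 0) (a : ℕ) :
    (∑' c, ef q 0 c) * qPochC q a = qPochC (q ^ 2) a * ∑' c, ef q a c := by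
  induction a with
  | zero => simp [qPochC]
  | succ a ih =>
    rw [ef_rec hq h0 a] at ih
    rw [qPochC_succ, qPochC_succ, ← mul_assoc, ih]
    ring

lemma ef_tendsto {q : ℂ} (hq : ‖q‖ < 1) (h0 : q ≠ 0) :
    Tendsto (fun a => ∑' c, ef q a c) atTop (𝓝 1) := by
  obtain ⟨M, hM0, hM⟩ := u_bound hq
  have : ∑' c : ℕ, (if c = 0 then (1 : ℂ) else 0) = 1 := by simp
  rw [← this]
  apply tendsto_tsum_of_dominated_convergence (bound := fun c => ‖q‖ ^ c * M)
  · exact (summable_geometric_of_lt_one (norm_nonneg _) hq).mul_right M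
  · intro c
    split_ifs with h
    · subst h
      simp [ef, u_zero, tri]
    · have h1 : Tendsto (fun a : ℕ => q ^ tri (c + 1) * (q ^ c) ^ a * u q c) atTop
          (𝓝 (q ^ tri (c + 1) * 0 * u q c)) := by
        apply ((tendsto_pow_atTop_nhds_zero_of_norm_lt_one _).const_mul _).mul_const
        rw [norm_pow]; exact pow_lt_one₀ (norm_nonneg _) hq h
      simp only [mul_zero, zero_mul] at h1
      apply h1.congr
      intro a
      unfold ef
      rw [zpow_add₀ h0, ← pow_mul, ← zpow_natCast]
      push_cast
      rw [mul_comm (c : ℤ)]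
  · filter_upwards with a c
    exact ef_bound hq h0 hM a c

lemma norm_sq_lt {q : ℂ} (hq : ‖q‖ < 1) : ‖q ^ 2‖ < 1 := by
  rw [norm_pow]; exact pow_lt_one₀ (norm_nonneg _) hq (by norm_num)

lemma ef_zero {q : ℂ} (hq : ‖q‖ < 1) (h0 : q ≠ 0) :
    ∑' c, ef q 0 c = qPochInfC (q ^ 2) / qPochInfC q := by
  have t1 := (tendsto_poch hq).const_mul (∑' c, ef q 0 c)
  have t2 := (tendsto_poch (norm_sq_lt hq)).mul (ef_tendsto hq h0)
  simp only [ef_prod hq h0] at t1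
  have := tendsto_nhds_unique t1 t2
  rw [eq_div_iff (pochInf_ne hq), this, mul_one]

/-- The four-fold summand. -/
noncomputable def term (q : ℂ) (p : (ℕ × ℕ) × (ℕ × ℕ)) : ℂ :=
  q ^ ex p.1.1 p.1.2 * (u q p.1.1 * u q p.1.2) * (ef q p.1.1 p.2.1 * ef q p.1.2 p.2.2)

lemma ex_ge (a b : ℕ) : ((a + b : ℕ) : ℤ) ≤ ex a b := by
  have h1 := abs_le_sq a
  have h2 := abs_le_sq b
  have h3 := tri_nonneg ((a : ℤ) + 1)
  have h4 := tri_nonneg (b : ℤ)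
  have h5 : (0 : ℤ) ≤ a * b := by positivity
  simp only [Int.natAbs_natCast] at h1 h2
  unfold ex
  push_cast
  linarith

lemma term_summable {q : ℂ} (hq : ‖q‖ < 1) (h0 : q ≠ 0) : Summable (term q) := by
  obtain ⟨M, hM0, hM⟩ := u_bound hq
  have g := summable_geometric_of_lt_one (norm_nonneg q) hq
  have g1 := g.mul_of_nonneg g (fun _ => by positivity) (fun _ => by positivity)
  have g2 := (g1.mul_right (M * M)).mul_of_nonneg (g1.mul_right (M * M))
    (fun _ => by positivity) (fun _ => by positivity)
  apply Summable.of_norm_bounded g2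
  rintro ⟨⟨a, b⟩, ⟨c, d⟩⟩
  simp only [term, norm_mul]
  have e1 := norm_zpow_le hq h0 _ _ (ex_ge a b)
  rw [pow_add] at e1
  have e2 := ef_bound hq h0 hM a c
  have e3 := ef_bound hq h0 hM b d
  calc _ ≤ (‖q‖ ^ a * ‖q‖ ^ b) * (M * M) * ((‖q‖ ^ c * M) * (‖q‖ ^ d * M)) := by
        gcongr
        · exact hM _
        · exact hM _
    _ = _ := by ring

lemma term_tsum {q : ℂ} (hq : ‖q‖ < 1) (h0 : q ≠ 0) :
    ∑' p, term q p = (qPochInfC (q ^ 2) / qPochInfC q) ^ 2 * ∑' j : ℕ, q ^ ((j : ℤ) ^ 2) * u q j := by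
  have hs := term_summable hq h0
  have hin : ∀ p : ℕ × ℕ, ∑' r : ℕ × ℕ, term q (p, r) =
      (∑' c, ef q 0 c) ^ 2 *
        (q ^ ex p.1 p.2 * ((qPochC (q ^ 2) p.1)⁻¹ * (qPochC (q ^ 2) p.2)⁻¹)) := by
    rintro ⟨a, b⟩
    simp only [term]
    rw [tsum_mul_left, ← tsum_mul_tsum_of_summable_norm (ef_summable hq h0 a) (ef_summable hq h0 b)]
    have na := qPochC_ne (norm_sq_lt hq) a
    have nb := qPochC_ne (norm_sq_lt hq) b
    have ma := qPochC_ne hq a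
    have mb := qPochC_ne hq b
    rw [u_nat, u_nat]
    have fa : ∑' c, ef q a c = (∑' c, ef q 0 c) * qPochC q a * (qPochC (q ^ 2) a)⁻¹ := by
      rw [ef_prod hq h0 a]; field_simp
    have fb : ∑' c, ef q b c = (∑' c, ef q 0 c) * qPochC q b * (qPochC (q ^ 2) b)⁻¹ := by
      rw [ef_prod hq h0 b]; field_simp
    rw [fa, fb]
    field_simp
  have hout := hs.prod
  rw [hs.tsum_prod]
  simp only [hin] at hout ⊢
  rw [← HasAntidiagonal.sigmaAntidiagonalEquivProd.summable_iff] at hout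
  rw [← HasAntidiagonal.sigmaAntidiagonalEquivProd.tsum_eq]
  refine (hout.tsum_sigma).trans ?_
  rw [← ef_zero hq h0,
    ← tsum_mul_left]
  congr 1
  ext N
  rw [u_nat, ← antidiag_sum hq h0 N, Finset.mul_sum]
  exact Finset.tsum_subtype (antidiagonal N) (fun p : ℕ × ℕ => (∑' c, ef q 0 c) ^ 2 *
        (q ^ ex p.1 p.2 * ((qPochC (q ^ 2) p.1)⁻¹ * (qPochC (q ^ 2) p.2)⁻¹)))

/-- Splitting quadruples into pairs of pairs. -/
def quad : (Fin 4 → ℕ) ≃ (ℕ × ℕ) × (ℕ × ℕ) where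
  toFun n := ((n 0, n 1), (n 2, n 3))
  invFun p := ![p.1.1, p.1.2, p.2.1, p.2.2]
  left_inv n := by ext i; fin_cases i <;> rfl
  right_inv p := rfl

lemma expo (a b c d : ℤ) :
    3 * a ^ 2 + 3 * b ^ 2 + 2 * a * b + 2 * a * c + 2 * b * d + c ^ 2 + d ^ 2 + a - b + c + d =
      2 * (ex a b + (tri (c + 1) + a * c) + (tri (d + 1) + b * d)) := by
  have h1 := two_tri (a + 1)
  have h2 := two_tri b
  have h3 := two_tri (c + 1)
  have h4 := two_tri (d + 1)
  unfold ex
  linarith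

lemma expo_nat (n : Fin 4 → ℕ) :
    ((∑ i, ∑ j, (n i : ℤ) * (Matrix.of ![![3, 1, 1, 0], ![1, 3, 0, 1], ![1, 0, 1, 0],
      ![0, 1, 0, 1]] : Matrix (Fin 4) (Fin 4) ℤ) i j * (n j : ℤ)) +
      ∑ i, (n i : ℤ) * (![1, -1, 1, 1] : Fin 4 → ℤ) i) / 2 =
      ex (n 0) (n 1) + (tri (n 2 + 1) + n 0 * n 2) + (tri (n 3 + 1) + n 1 * n 3) := by
  apply Int.ediv_eq_of_eq_mul_right (by norm_num)
  rw [← expo]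
  simp [Fin.sum_univ_four]
  ring

lemma theta_expo (k : ℤ) : (5 * k ^ 2 + k) / 2 = tri (-k) + 2 * (-k) ^ 2 := by
  apply Int.ediv_eq_of_eq_mul_right (by norm_num)
  have := two_tri (-k)
  linarith

lemma theta_eq (q : ℂ) : ∑' k : ℤ, (-1 : ℂ) ^ k * q ^ ((5 * k ^ 2 + k) / 2) =
    ∑' k : ℤ, (-1 : ℂ) ^ k * q ^ (tri k + 2 * k ^ 2) := by
  rw [← (Equiv.neg ℤ).tsum_eq (fun k : ℤ => (-1 : ℂ) ^ k * q ^ (tri k + 2 * k ^ 2))]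
  congr 1
  ext k
  simp only [Equiv.neg_apply]
  rw [theta_expo, zpow_neg, ← inv_zpow, inv_neg_one]

end RRNahm

/-- Let `A` be the 4×4 matrix with rows `(3,1,1,0)`, `(1,3,0,1)`,
`(1,0,1,0)`, `(0,1,0,1)` and `B = (1/2, -1/2, 1/2, 1/2)`.  For every complex `q` with
`|q| < 1` (the exponents `½nᵀAn + nᵀB = (nᵀAn + nᵀ(2B))/2` being nonnegative integers):
`∑_{n ∈ (ℤ_{≥0})⁴} q^{½nᵀAn + nᵀB} / ((q)_{n₁}(q)_{n₂}(q)_{n₃}(q)_{n₄})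
  = ((q²;q²)_∞² / (q;q)_∞³) ∑_{k ∈ ℤ} (-1)^k q^{(5k²+k)/2}`. -/
theorem nahmSum_rank_four_counterexample (q : ℂ) (hq : ‖q‖ < 1)
    (A : Matrix (Fin 4) (Fin 4) ℤ)
    (hA : A = Matrix.of ![![3, 1, 1, 0], ![1, 3, 0, 1], ![1, 0, 1, 0], ![0, 1, 0, 1]])
    (B2 : Fin 4 → ℤ) (hB2 : B2 = ![1, -1, 1, 1]) :
    (∑' n : Fin 4 → ℕ,
        q ^ (((∑ i, ∑ j, (n i : ℤ) * A i j * (n j : ℤ)) + ∑ i, (n i : ℤ) * B2 i) / 2) /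
          ∏ i, qPochC q (n i)) =
      (qPochInfC (q ^ 2)) ^ 2 / (qPochInfC q) ^ 3 *
        ∑' k : ℤ, (-1 : ℂ) ^ k * q ^ ((5 * k ^ 2 + k) / 2) := by
  subst hA hB2
  simp only [RRNahm.expo_nat]
  rw [RRNahm.theta_eq]
  by_cases h0 : q = 0
  · subst h0
    rw [tsum_eq_single 0, tsum_eq_single 0]
    · simp [RRNahm.ex, RRNahm.tri, qPochC, qPochInfC]
    · intro k hk
      rw [zero_zpow, mul_zero]
      have h1 := RRNahm.tri_nonneg k
      have h2 : 0 < k ^ 2 := by positivity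
      omega
    · intro n hn
      rw [zero_zpow, zero_div]
      intro h
      apply hn
      have h1 := RRNahm.ex_ge (n 0) (n 1)
      have h2 := RRNahm.tri_succ_ge (n 2)
      have h3 := RRNahm.tri_succ_ge (n 3)
      have h4 : (0 : ℤ) ≤ n 0 * n 2 := by positivity
      have h5 : (0 : ℤ) ≤ n 1 * n 3 := by positivity
      push_cast at h1
      have h6 : n 0 = 0 ∧ n 1 = 0 ∧ n 2 = 0 ∧ n 3 = 0 := by
        refine ⟨?_, ?_, ?_, ?_⟩ <;> zify <;> linarith
      obtain ⟨a1, a2, a3, a4⟩ := h6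
      ext i
      fin_cases i
      · exact a1
      · exact a2
      · exact a3
      · exact a4
  · have hterm : ∀ n : Fin 4 → ℕ,
        q ^ (RRNahm.ex (n 0) (n 1) + (RRNahm.tri (n 2 + 1) + n 0 * n 2) +
          (RRNahm.tri (n 3 + 1) + n 1 * n 3)) / ∏ i, qPochC q (n i) =
        RRNahm.term q (RRNahm.quad n) := by
      intro n
      have hquad : RRNahm.quad n = ((n 0, n 1), (n 2, n 3)) := rfl
      simp only [hquad, RRNahm.term, RRNahm.ef, RRNahm.u_nat]
      rw [Fin.prod_univ_four, zpow_add₀ h0, zpow_add₀ h0, div_eq_mul_inv]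
      simp only [mul_inv]
      ring
    simp only [hterm]
    rw [RRNahm.quad.tsum_eq, RRNahm.term_tsum hq h0, RRNahm.rr hq h0]
    have := RRNahm.pochInf_ne hq
    field_simp
end
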